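/- arXiv:2012.12980 — 8 statements merged into one kernel-verified Lean document; each statement's English description precedes it below -/
import Mathlib

section
/- For all positive integers k₁, k₂ and all real x with 0 < x < 1, the following identity holds: ₃F₂(1, (k₁+k₂)/2 + 1, (k₁+k₂+1)/2; k₁+1, k₂+1; x) = (k₁!·k₂!/(k₁+k₂)!) · (2^{k₁+k₂}/x^{k₂}) · (1+√(1−x))^{k₂−k₁}/√(1−x) + (k₂/((k₁+k₂)√(1−x))) · [ ₂F₁(1, k₁+k₂; k₁+1; 1/2 − √(1−x)/2) − ₂F₁(1, k₁+k₂; k₁+1; 1/2 + √(1−x)/2) ]. -/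
/-- The hypergeometric series ₂F₁(a,b;d;x). -/
noncomputable def hyp2F1 (a b d x : ℝ) : ℝ :=
  ∑' n : ℕ,
    ((ascPochhammer ℝ n).eval a * (ascPochhammer ℝ n).eval b) /
      ((ascPochhammer ℝ n).eval d * (n.factorial : ℝ)) * x ^ n

/-- The hypergeometric series ₃F₂(a,b,c;d,e;x). -/
noncomputable def hyp3F2 (a b c d e x : ℝ) : ℝ :=
  ∑' n : ℕ,
    ((ascPochhammer ℝ n).eval a * (ascPochhammer ℝ n).eval b * (ascPochhammer ℝ n).eval c) /
      ((ascPochhammer ℝ n).eval d * (ascPochhammer ℝ n).eval e * (n.factorial : ℝ)) * x ^ n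

open Filter Topology

/-- The diagonal binomial series `∑ C(a + b + 2n, a + n) yⁿ`. -/
noncomputable def diagChooseSeries (y : ℝ) (a b : ℕ) : ℝ :=
  ∑' n : ℕ, ((a + b + 2 * n).choose (a + n) : ℝ) * y ^ n

/-- The negative binomial tail series `∑ C(a + b + n, b) zⁿ`. -/
noncomputable def chooseTailSeries (z : ℝ) (a b : ℕ) : ℝ :=
  ∑' n : ℕ, ((a + b + n).choose b : ℝ) * z ^ n

theorem diagChoose_term_le {y : ℝ} (hy : 0 ≤ y) (a b n : ℕ) :
    ((a + b + 2 * n).choose (a + n) : ℝ) * y ^ n ≤ 2 ^ (a + b) * (4 * y) ^ n := by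
  have h : ((a + b + 2 * n).choose (a + n) : ℝ) ≤ 2 ^ (a + b + 2 * n) := by
    exact_mod_cast Nat.choose_le_two_pow _ _
  calc _ ≤ (2 : ℝ) ^ (a + b + 2 * n) * y ^ n := by gcongr
    _ = _ := by rw [pow_add, pow_mul, mul_pow]; norm_num; ring

theorem summable_diagChoose {y : ℝ} (hy : 0 ≤ y) (hy4 : 4 * y < 1) (a b : ℕ) :
    Summable fun n : ℕ => ((a + b + 2 * n).choose (a + n) : ℝ) * y ^ n :=
  .of_nonneg_of_le (fun _ => by positivity) (diagChoose_term_le hy a b)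
    ((summable_geometric_of_lt_one (by positivity) hy4).mul_left _)

theorem diagChooseSeries_nonneg {y : ℝ} (hy : 0 ≤ y) (a b : ℕ) :
    0 ≤ diagChooseSeries y a b :=
  tsum_nonneg fun _ => by positivity

theorem diagChooseSeries_le {y : ℝ} (hy : 0 ≤ y) (hy4 : 4 * y < 1) (a b : ℕ) :
    diagChooseSeries y a b ≤ 2 ^ (a + b) * (1 - 4 * y)⁻¹ := by
  rw [← tsum_geometric_of_lt_one (by positivity) hy4, ← tsum_mul_left]
  exact (summable_diagChoose hy hy4 a b).tsum_le_tsum (diagChoose_term_le hy a b)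
    ((summable_geometric_of_lt_one (by positivity) hy4).mul_left _)

theorem diagChooseSeries_comm (y : ℝ) (a b : ℕ) :
    diagChooseSeries y a b = diagChooseSeries y b a := by
  unfold diagChooseSeries
  congr! 4 with n
  exact (congrArg (Nat.choose · (a + n)) (by ring : a + b + 2 * n = b + a + 2 * n)).trans
    (Nat.choose_symm_of_eq_add (show b + a + 2 * n = (a + n) + (b + n) by ring))

theorem diagChooseSeries_succ_succ {y : ℝ} (hy : 0 ≤ y) (hy4 : 4 * y < 1) (a b : ℕ) :
    diagChooseSeries y (a + 1) (b + 1) =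
      diagChooseSeries y a (b + 1) + diagChooseSeries y (a + 1) b := by
  unfold diagChooseSeries
  rw [← (summable_diagChoose hy hy4 a (b + 1)).tsum_add (summable_diagChoose hy hy4 (a + 1) b)]
  congr! 2 with n
  rw [show a + 1 + (b + 1) + 2 * n = a + b + 1 + 2 * n + 1 by ring,
    show a + 1 + n = a + n + 1 by ring, Nat.choose_succ_succ,
    show a + (b + 1) + 2 * n = a + b + 1 + 2 * n by ring,
    show a + 1 + b + 2 * n = a + b + 1 + 2 * n by ring]
  push_cast
  ring

theorem diagChooseSeries_shift {y : ℝ} (hy : 0 ≤ y) (hy4 : 4 * y < 1) (a b : ℕ) :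
    diagChooseSeries y a b = (a + b).choose a + y * diagChooseSeries y (a + 1) (b + 1) := by
  unfold diagChooseSeries
  rw [(summable_diagChoose hy hy4 a b).tsum_eq_zero_add, ← tsum_mul_left]
  congr 1
  · simp
  · congr! 2 with n
    rw [show a + b + 2 * (n + 1) = a + 1 + (b + 1) + 2 * n by ring,
      show a + (n + 1) = a + 1 + n by ring]
    ring

theorem diagChooseSeries_left_recurrence {y : ℝ} (hy : 0 ≤ y) (hy4 : 4 * y < 1) (a : ℕ) :
    diagChooseSeries y (a + 1) 0 = diagChooseSeries y a 0 + y * diagChooseSeries y (a + 2) 0 := by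
  have h₀ := diagChooseSeries_shift hy hy4 a 0
  have h₁ := diagChooseSeries_shift hy hy4 (a + 1) 0
  have h₂ := diagChooseSeries_succ_succ hy hy4 (a + 1) 0
  norm_num at h₀ h₁ h₂
  rw [h₂] at h₁
  linarith

theorem diagChooseSeries_zero_right {u v : ℝ} (hu : 0 < u) (huv : u < v) (h : u + v = 1) (a : ℕ) :
    diagChooseSeries (u * v) a 0 = (v ^ a)⁻¹ / (v - u) := by
  have hv : 0 < v := hu.trans huv
  have hy : 0 ≤ u * v := by positivity
  have hy4 : 4 * (u * v) < 1 := by nlinarith [sq_pos_of_pos (sub_pos.2 huv)]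
  set f : ℕ → ℝ := fun a => diagChooseSeries (u * v) a 0
  have he (a : ℕ) : v * f 1 - f 0 = u ^ a * (v * f (a + 1) - f a) := by
    induction a with
    | zero => simp
    | succ a ih =>
      have := diagChooseSeries_left_recurrence hy hy4 a
      change f (a + 1) = f a + u * v * f (a + 2) at this
      have h' : f a = (u + v) * f (a + 1) - u * v * f (a + 2) := by rw [h]; linarith
      rw [ih, h']
      ring
  have hlim : Tendsto (fun a => u ^ a * f a) atTop (𝓝 0) := by
    refine squeeze_zero (g := fun a => (2 * u) ^ a * (1 - 4 * (u * v))⁻¹)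
      (fun a => mul_nonneg (by positivity) (diagChooseSeries_nonneg hy a 0)) (fun a => ?_) ?_
    · have := diagChooseSeries_le hy hy4 a 0
      rw [mul_pow, mul_comm (2 ^ a), mul_assoc]
      exact mul_le_mul_of_nonneg_left this (by positivity)
    · simpa using (tendsto_pow_atTop_nhds_zero_of_lt_one (by positivity)
        (by linarith : 2 * u < 1)).mul_const (1 - 4 * (u * v))⁻¹
  have hlim' : Tendsto (fun a => u ^ a * (v * f (a + 1) - f a)) atTop (𝓝 0) := by
    have := ((hlim.comp (tendsto_add_atTop_nat 1)).const_mul (v / u)).sub hlim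
    simp only [mul_zero, sub_zero] at this
    refine this.congr fun a => ?_
    simp only [Function.comp_apply, pow_succ]
    field_simp
  have hzero : v * f 1 - f 0 = 0 :=
    tendsto_nhds_unique (tendsto_const_nhds.congr he) hlim'
  have hstep (a : ℕ) : v * f (a + 1) = f a := by
    have := he a
    rw [hzero, eq_comm, mul_eq_zero] at this
    exact sub_eq_zero.1 (this.resolve_left (by positivity))
  have hf0 : f 0 = 1 + u * v * (2 * f 1) := by
    have h₀ := diagChooseSeries_shift hy hy4 0 0
    have h₁ := diagChooseSeries_succ_succ hy hy4 0 0
    rw [diagChooseSeries_comm _ 0] at h₁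
    norm_num at h₀ h₁
    rw [h₁, ← two_mul] at h₀
    exact h₀
  have hne : v - u ≠ 0 := (sub_pos.2 huv).ne'
  change f a = _
  induction a with
  | zero =>
    have := hstep 0
    rw [eq_div_iff hne]
    norm_num at this ⊢
    have h2 : u * v * (2 * f 1) = 2 * u * f 0 := by rw [← this]; ring
    rw [h2] at hf0
    linear_combination hf0 + f 0 * h
  | succ a ih =>
    rw [← hstep a] at ih
    rw [pow_succ, mul_inv]
    field_simp at ih ⊢
    linarith

theorem summable_chooseTail {z : ℝ} (hz0 : 0 < z) (hz1 : z < 1) (a b : ℕ) :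
    Summable fun n : ℕ => ((a + b + n).choose b : ℝ) * z ^ n := by
  have := (summable_nat_add_iff a).2 (summable_choose_mul_geometric_of_norm_lt_one b
    (r := z) (by rwa [Real.norm_of_nonneg hz0.le]))
  refine (this.mul_right (z ^ a)⁻¹).congr fun n => ?_
  rw [show n + a + b = a + b + n by ring, pow_add]
  field_simp

theorem chooseTailSeries_zero_left {z : ℝ} (hz0 : 0 < z) (hz1 : z < 1) (b : ℕ) :
    chooseTailSeries z 0 b = 1 / (1 - z) ^ (b + 1) := by
  rw [← tsum_choose_mul_geometric_of_norm_lt_one b (by rwa [Real.norm_of_nonneg hz0.le])]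
  simp [chooseTailSeries, add_comm]

theorem chooseTailSeries_zero_right (z : ℝ) (a : ℕ) :
    chooseTailSeries z (a + 1) 0 = chooseTailSeries z a 0 := by
  simp [chooseTailSeries]

theorem chooseTailSeries_succ_succ {z : ℝ} (hz0 : 0 < z) (hz1 : z < 1) (a b : ℕ) :
    chooseTailSeries z (a + 1) (b + 1) =
      chooseTailSeries z a (b + 1) + chooseTailSeries z (a + 1) b := by
  unfold chooseTailSeries
  rw [← (summable_chooseTail hz0 hz1 a (b + 1)).tsum_add (summable_chooseTail hz0 hz1 (a + 1) b)]
  congr! 2 with n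
  rw [show a + 1 + (b + 1) + n = a + b + 1 + n + 1 by ring, Nat.choose_succ_succ,
    show a + (b + 1) + n = a + b + 1 + n by ring, show a + 1 + b + n = a + b + 1 + n by ring]
  push_cast
  ring

theorem diagChooseSeries_succ_right {u v : ℝ} (hu : 0 < u) (huv : u < v) (h : u + v = 1)
    (a b : ℕ) :
    diagChooseSeries (u * v) a (b + 1) =
      ((u ^ (b + 1) * v ^ a)⁻¹ + (chooseTailSeries u a b - chooseTailSeries v a b)) / (v - u) := by
  have hv : 0 < v := hu.trans huv
  have hy : 0 ≤ u * v := by positivity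
  have hy4 : 4 * (u * v) < 1 := by nlinarith [sq_pos_of_pos (sub_pos.2 huv)]
  have hpow (a b : ℕ) : (u ^ (b + 1) * v ^ (a + 1))⁻¹ =
      (u ^ (b + 1) * v ^ a)⁻¹ + (u ^ b * v ^ (a + 1))⁻¹ := by
    field_simp
    linear_combination -(v ^ a * u ^ b) * h
  induction a generalizing b with
  | zero =>
    rw [diagChooseSeries_comm, diagChooseSeries_zero_right hu huv h,
      chooseTailSeries_zero_left hu (by linarith), chooseTailSeries_zero_left hv (by linarith),
      ← eq_sub_of_add_eq h, ← eq_sub_of_add_eq' h]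
    congr 1
    simp
  | succ a iha =>
    induction b with
    | zero =>
      rw [diagChooseSeries_succ_succ hy hy4, iha, diagChooseSeries_zero_right hu huv h,
        chooseTailSeries_zero_right, chooseTailSeries_zero_right, hpow, pow_zero, one_mul]
      ring
    | succ b ihb =>
      rw [diagChooseSeries_succ_succ hy hy4, iha, ihb, hpow a (b + 1),
        chooseTailSeries_succ_succ hu (by linarith), chooseTailSeries_succ_succ hv (by linarith)]
      ring

theorem ascPochhammer_eval_succ_mul_factorial (k n : ℕ) :
    (ascPochhammer ℝ n).eval ((k : ℝ) + 1) * (k.factorial : ℝ) = ((k + n).factorial : ℝ) := by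
  have := Nat.factorial_mul_ascFactorial k n
  rw [← ascPochhammer_nat_eq_ascFactorial] at this
  rw [← this, Nat.cast_mul, ascPochhammer_eval_cast, Nat.cast_succ, mul_comm]

theorem ascPochhammer_eval_half_mul_half (c : ℝ) (n : ℕ) :
    (ascPochhammer ℝ n).eval (c / 2 + 1) * (ascPochhammer ℝ n).eval ((c + 1) / 2) * 4 ^ n =
      (ascPochhammer ℝ (2 * n)).eval (c + 1) := by
  induction n with
  | zero => simp
  | succ n ih =>
    rw [show 2 * (n + 1) = 2 * n + 1 + 1 by ring]
    simp only [ascPochhammer_succ_eval, pow_succ]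
    rw [← ih]
    push_cast
    ring

theorem ascPochhammer_eval_one_eq_factorial (n : ℕ) :
    (ascPochhammer ℝ n).eval 1 = (n.factorial : ℝ) := by
  simp

theorem hyp3F2_eq_diagChooseSeries (a b : ℕ) (y : ℝ) :
    hyp3F2 1 (((a : ℝ) + (b : ℝ)) / 2 + 1) (((a : ℝ) + (b : ℝ) + 1) / 2)
        ((a : ℝ) + 1) ((b : ℝ) + 1) (4 * y) =
      (a.factorial : ℝ) * (b.factorial : ℝ) / ((a + b).factorial : ℝ) *
        diagChooseSeries y a b := by
  unfold hyp3F2 diagChooseSeries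
  rw [← tsum_mul_left]
  congr! 2 with n
  have hN := ascPochhammer_eval_succ_mul_factorial (a + b) (2 * n)
  have ha := ascPochhammer_eval_succ_mul_factorial a n
  have hb := ascPochhammer_eval_succ_mul_factorial b n
  have h4 := ascPochhammer_eval_half_mul_half ((a : ℝ) + b) n
  push_cast at hN
  have hfa : (a.factorial : ℝ) ≠ 0 := by positivity
  have hfb : (b.factorial : ℝ) ≠ 0 := by positivity
  have hfN : ((a + b).factorial : ℝ) ≠ 0 := by positivity
  rw [show a + b + 2 * n = (a + n) + (b + n) by ring] at hN ⊢
  rw [Nat.cast_add_choose, ← hN, ← h4, ← ha, ← hb, ascPochhammer_eval_one_eq_factorial, mul_pow]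
  have hpa := (ascPochhammer_pos n ((a : ℝ) + 1) (by positivity)).ne'
  have hpb := (ascPochhammer_pos n ((b : ℝ) + 1) (by positivity)).ne'
  field_simp

theorem hyp2F1_eq_chooseTailSeries (a b : ℕ) (z : ℝ) :
    ((a + b).factorial : ℝ) * hyp2F1 1 ((a : ℝ) + ((b : ℝ) + 1)) ((a : ℝ) + 1) z =
      (a.factorial : ℝ) * (b.factorial : ℝ) * chooseTailSeries z a b := by
  unfold hyp2F1 chooseTailSeries
  rw [← tsum_mul_left, ← tsum_mul_left]
  congr! 2 with n
  have hN := ascPochhammer_eval_succ_mul_factorial (a + b) n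
  have ha := ascPochhammer_eval_succ_mul_factorial a n
  push_cast at hN
  have hfa : (a.factorial : ℝ) ≠ 0 := by positivity
  have hfb : (b.factorial : ℝ) ≠ 0 := by positivity
  rw [show a + b + n = b + (a + n) by ring] at hN ⊢
  rw [Nat.cast_add_choose, ← hN, ← ha, ascPochhammer_eval_one_eq_factorial, ← add_assoc]
  have hpa := (ascPochhammer_pos n ((a : ℝ) + 1) (by positivity)).ne'
  field_simp

theorem stmt3 (k1 k2 : ℕ) (hk1 : 0 < k1) (hk2 : 0 < k2) (x : ℝ) (hx0 : 0 < x) (hx1 : x < 1) :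
    hyp3F2 1 (((k1 : ℝ) + (k2 : ℝ)) / 2 + 1) (((k1 : ℝ) + (k2 : ℝ) + 1) / 2)
        ((k1 : ℝ) + 1) ((k2 : ℝ) + 1) x =
      ((k1.factorial : ℝ) * (k2.factorial : ℝ) / ((k1 + k2).factorial : ℝ)) *
        (2 ^ (k1 + k2) / x ^ k2) *
        (1 + Real.sqrt (1 - x)) ^ ((k2 : ℤ) - (k1 : ℤ)) / Real.sqrt (1 - x) +
      (k2 : ℝ) / (((k1 : ℝ) + (k2 : ℝ)) * Real.sqrt (1 - x)) *
        (hyp2F1 1 ((k1 : ℝ) + (k2 : ℝ)) ((k1 : ℝ) + 1) (1 / 2 - Real.sqrt (1 - x) / 2) -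
         hyp2F1 1 ((k1 : ℝ) + (k2 : ℝ)) ((k1 : ℝ) + 1) (1 / 2 + Real.sqrt (1 - x) / 2)) := by
  obtain ⟨b, rfl⟩ : ∃ b, k2 = b + 1 := ⟨k2 - 1, by omega⟩
  set s := Real.sqrt (1 - x)
  have hs0 : 0 < s := Real.sqrt_pos.2 (by linarith)
  have hsx : s ^ 2 = 1 - x := Real.sq_sqrt (by linarith)
  have hs1 : s < 1 := by nlinarith
  obtain ⟨u, hu⟩ : ∃ u, u = 1 / 2 - s / 2 := ⟨_, rfl⟩
  obtain ⟨v, hv⟩ : ∃ v, v = 1 / 2 + s / 2 := ⟨_, rfl⟩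
  have hu0 : 0 < u := by linarith
  have hv0 : 0 < v := by linarith
  have hx : x = 4 * (u * v) := by rw [hu, hv]; linarith
  have h1s : 1 + s = 2 * v := by linarith
  have hsub : s = v - u := by linarith
  have hfirst : (2 : ℝ) ^ (k1 + (b + 1)) / x ^ (b + 1) *
      (1 + s) ^ (((b + 1 : ℕ) : ℤ) - (k1 : ℤ)) = (u ^ (b + 1) * v ^ k1)⁻¹ := by
    rw [h1s, hx, zpow_sub₀ (by positivity), zpow_natCast, zpow_natCast,
      show (4 : ℝ) = 2 * 2 by norm_num]
    simp only [mul_pow, pow_add]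
    field_simp
  have hFu := hyp2F1_eq_chooseTailSeries k1 b u
  have hFv := hyp2F1_eq_chooseTailSeries k1 b v
  have hsum := hyp3F2_eq_diagChooseSeries k1 (b + 1) (u * v)
  rw [diagChooseSeries_succ_right hu0 (by linarith) (by linarith), ← hsub, ← hx] at hsum
  rw [hsum, mul_assoc (_ / _) (_ / _), hfirst, ← hu, ← hv]
  have hfac : ((k1 + (b + 1)).factorial : ℝ) = (k1 + (b + 1)) * ((k1 + b).factorial : ℝ) := by
    rw [← add_assoc, Nat.factorial_succ]
    push_cast
    ring
  have hfac' : ((b + 1).factorial : ℝ) = (b + 1) * (b.factorial : ℝ) := by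
    rw [Nat.factorial_succ]
    push_cast
    ring
  have hfN : ((k1 + b).factorial : ℝ) ≠ 0 := by positivity
  have hN : (k1 : ℝ) + (b + 1) ≠ 0 := by positivity
  push_cast
  rw [mul_comm, ← eq_div_iff hfN] at hFu hFv
  rw [hFu, hFv, hfac, hfac']
  field_simp
end

section
/- For all positive integers k₁, k₂ and all real x with 0 < x < 1, the following identity holds: ₃F₂(1, (k₁+k₂)/2 + 1, (k₁+k₂+1)/2; k₁+1, k₂+1; x) = (1/((k₁+k₂)√(1−x))) · [ k₂ · ₂F₁(1, k₁+k₂; k₁+1; 1/2 − √(1−x)/2) + k₁ · ₂F₁(1, k₁+k₂; k₂+1; 1/2 − √(1−x)/2) ]. -/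
open Nat in
theorem ascPochhammer_eval_cast_add_one_mul_factorial (k n : ℕ) :
    (ascPochhammer ℝ n).eval ((k : ℝ) + 1) * (k ! : ℝ) = ((k + n)! : ℕ) := by
  induction n with
  | zero => simp
  | succ n ih =>
    rw [ascPochhammer_succ_eval, mul_right_comm, ih, ← add_assoc, Nat.factorial_succ]
    push_cast
    ring

open Nat in
theorem ascPochhammer_eval_duplication (k n : ℕ) :
    (ascPochhammer ℝ n).eval ((k : ℝ) / 2 + 1) * (ascPochhammer ℝ n).eval (((k : ℝ) + 1) / 2) *
      4 ^ n * (k ! : ℝ) = ((k + 2 * n)! : ℕ) := by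
  induction n with
  | zero => simp
  | succ n ih =>
    rw [ascPochhammer_succ_eval, ascPochhammer_succ_eval,
      show k + 2 * (n + 1) = k + 2 * n + 1 + 1 by ring, Nat.factorial_succ, Nat.factorial_succ]
    push_cast
    rw [← ih]
    ring

/-- The series `∑ C(a + b + 2n, a + n) tⁿ`. -/
noncomputable def diagonalBinomialSeries (t : ℝ) (a b : ℕ) : ℝ :=
  ∑' n : ℕ, ((a + b + 2 * n).choose (a + n) : ℝ) * t ^ n

/-- The series `∑ C(a + b + n - 1, a + n) uⁿ`. -/
noncomputable def shiftedBinomialSeries (u : ℝ) (a b : ℕ) : ℝ :=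
  ∑' n : ℕ, ((a + b + n - 1).choose (a + n) : ℝ) * u ^ n

theorem choose_mul_pow_le {t : ℝ} (ht : 0 ≤ t) (a b n : ℕ) :
    ((a + b + 2 * n).choose (a + n) : ℝ) * t ^ n ≤ 2 ^ (a + b) * (4 * t) ^ n := by
  have h : ((a + b + 2 * n).choose (a + n) : ℝ) ≤ 2 ^ (a + b + 2 * n) :=
    mod_cast Nat.choose_le_two_pow _ _
  calc _ ≤ 2 ^ (a + b + 2 * n) * t ^ n := by gcongr
    _ = _ := by rw [pow_add, pow_mul, mul_pow]; ring

theorem summable_diagonalBinomialSeries {t : ℝ} (ht : 0 ≤ t) (ht' : 4 * t < 1) (a b : ℕ) :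
    Summable fun n : ℕ => ((a + b + 2 * n).choose (a + n) : ℝ) * t ^ n :=
  .of_nonneg_of_le (fun _ => by positivity) (choose_mul_pow_le ht a b)
    ((summable_geometric_of_lt_one (by positivity) ht').mul_left _)

theorem diagonalBinomialSeries_nonneg {t : ℝ} (ht : 0 ≤ t) (a b : ℕ) :
    0 ≤ diagonalBinomialSeries t a b :=
  tsum_nonneg fun _ => by positivity

theorem diagonalBinomialSeries_le {t : ℝ} (ht : 0 ≤ t) (ht' : 4 * t < 1) (a b : ℕ) :
    diagonalBinomialSeries t a b ≤ 2 ^ (a + b) * (1 - 4 * t)⁻¹ := by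
  rw [← tsum_geometric_of_lt_one (by positivity) ht', ← tsum_mul_left]
  exact (summable_diagonalBinomialSeries ht ht' a b).tsum_le_tsum (choose_mul_pow_le ht a b)
    ((summable_geometric_of_lt_one (by positivity) ht').mul_left _)

theorem diagonalBinomialSeries_comm (t : ℝ) (a b : ℕ) :
    diagonalBinomialSeries t a b = diagonalBinomialSeries t b a := by
  refine tsum_congr fun n => ?_
  rw [Nat.choose_symm_of_eq_add (show a + b + 2 * n = (a + n) + (b + n) by ring), add_comm a b]

theorem diagonalBinomialSeries_pascal {t : ℝ} (ht : 0 ≤ t) (ht' : 4 * t < 1) (a b : ℕ) :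
    diagonalBinomialSeries t (a + 1) (b + 1) =
      diagonalBinomialSeries t a (b + 1) + diagonalBinomialSeries t (a + 1) b := by
  unfold diagonalBinomialSeries
  rw [← (summable_diagonalBinomialSeries ht ht' _ _).tsum_add
    (summable_diagonalBinomialSeries ht ht' _ _)]
  refine tsum_congr fun n => ?_
  rw [show a + 1 + (b + 1) + 2 * n = (a + b + 1 + 2 * n) + 1 by ring,
    show a + 1 + n = (a + n) + 1 by ring, Nat.choose_succ_succ',
    show a + (b + 1) + 2 * n = a + b + 1 + 2 * n by ring,
    show a + 1 + b + 2 * n = a + b + 1 + 2 * n by ring]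
  push_cast
  ring

theorem summable_shiftedBinomialSeries {u : ℝ} (hu : 0 ≤ u) (hu' : 2 * u < 1) (a b : ℕ) :
    Summable fun n : ℕ => ((a + b + n - 1).choose (a + n) : ℝ) * u ^ n := by
  refine .of_nonneg_of_le (fun _ => by positivity) (fun n => ?_)
    ((summable_geometric_of_lt_one (by positivity) hu').mul_left (2 ^ (a + b)))
  have h : ((a + b + n - 1).choose (a + n) : ℝ) ≤ 2 ^ (a + b + n) :=
    mod_cast (Nat.choose_le_two_pow _ _).trans (Nat.pow_le_pow_right two_pos (Nat.sub_le _ _))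
  calc _ ≤ 2 ^ (a + b + n) * u ^ n := by gcongr
    _ = _ := by rw [pow_add, mul_pow]; ring

theorem shiftedBinomialSeries_pascal {u : ℝ} (hu : 0 ≤ u) (hu' : 2 * u < 1) (a b : ℕ) :
    shiftedBinomialSeries u (a + 1) (b + 1) =
      shiftedBinomialSeries u a (b + 1) + shiftedBinomialSeries u (a + 1) b := by
  unfold shiftedBinomialSeries
  rw [← (summable_shiftedBinomialSeries hu hu' _ _).tsum_add
    (summable_shiftedBinomialSeries hu hu' _ _)]
  refine tsum_congr fun n => ?_
  rw [show a + 1 + (b + 1) + n - 1 = (a + b + n) + 1 by lia,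
    show a + 1 + n = (a + n) + 1 by ring, Nat.choose_succ_succ',
    show a + (b + 1) + n - 1 = a + b + n by lia,
    show a + 1 + b + n - 1 = a + b + n by lia]
  push_cast
  ring

theorem shiftedBinomialSeries_succ_zero (u : ℝ) (a : ℕ) :
    shiftedBinomialSeries u (a + 1) 0 = 0 := by
  have h (n : ℕ) : (a + 1 + 0 + n - 1).choose (a + 1 + n) = 0 :=
    Nat.choose_eq_zero_of_lt (by lia)
  simp only [shiftedBinomialSeries, h, Nat.cast_zero, zero_mul, tsum_zero]

theorem shiftedBinomialSeries_zero_succ {u : ℝ} (hu : 0 ≤ u) (hu' : 2 * u < 1) (b : ℕ) :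
    shiftedBinomialSeries u 0 (b + 1) = 1 / (1 - u) ^ (b + 1) := by
  rw [← tsum_choose_mul_geometric_of_norm_lt_one b
    (show ‖u‖ < 1 by rw [Real.norm_of_nonneg hu]; linarith)]
  refine tsum_congr fun n => ?_
  rw [show 0 + (b + 1) + n - 1 = n + b by lia, zero_add,
    Nat.choose_symm_add]

theorem diagonalBinomialSeries_zero_succ {t : ℝ} (ht : 0 ≤ t) (ht' : 4 * t < 1) (b : ℕ) :
    diagonalBinomialSeries t 0 (b + 1) =
      diagonalBinomialSeries t 0 b + t * diagonalBinomialSeries t 0 (b + 2) := by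
  have h (b : ℕ) := summable_diagonalBinomialSeries ht ht' 0 b
  unfold diagonalBinomialSeries
  rw [(h _).tsum_eq_zero_add, (h b).tsum_eq_zero_add, ← tsum_mul_left,
    add_assoc (_ * _), ← ((summable_nat_add_iff 1).2 (h b)).tsum_add ((h (b + 2)).mul_left t)]
  congr 1
  · simp
  refine tsum_congr fun n => ?_
  rw [show 0 + (b + 1) + 2 * (n + 1) = (b + 2 + 2 * n) + 1 by ring,
    show 0 + b + 2 * (n + 1) = b + 2 + 2 * n by ring,
    show 0 + (n + 1) = n + 1 by ring, Nat.choose_succ_succ', zero_add, zero_add]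
  push_cast
  ring

theorem diagonalBinomialSeries_zero_zero {t : ℝ} (ht : 0 ≤ t) (ht' : 4 * t < 1) :
    diagonalBinomialSeries t 0 0 = 1 + 2 * t * diagonalBinomialSeries t 0 1 := by
  unfold diagonalBinomialSeries
  rw [(summable_diagonalBinomialSeries ht ht' 0 0).tsum_eq_zero_add, ← tsum_mul_left]
  congr 1
  · simp
  refine tsum_congr fun n => ?_
  rw [show 0 + 0 + 2 * (n + 1) = (2 * n + 1) + 1 by ring, show 0 + (n + 1) = n + 1 by ring,
    Nat.choose_succ_succ', Nat.choose_symm_half, show 0 + 1 + 2 * n = 2 * n + 1 by ring, zero_add]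
  push_cast
  ring

section QuadraticParameter

variable {u : ℝ}

/-- `diagonalBinomialSeries` along `a = 0` satisfies a linear recurrence with characteristic roots
`1 / (1 - u)` and `1 / u`; its growth is too slow for the second root to contribute. -/
theorem one_sub_mul_diagonalBinomialSeries (hu : 0 ≤ u) (hu' : 2 * u < 1) (b : ℕ) :
    (1 - u) * diagonalBinomialSeries (u * (1 - u)) 0 (b + 1) =
      diagonalBinomialSeries (u * (1 - u)) 0 b := by
  have ht : 0 ≤ u * (1 - u) := mul_nonneg hu (by linarith)
  have ht' : 4 * (u * (1 - u)) < 1 := by nlinarith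
  set B := diagonalBinomialSeries (u * (1 - u)) 0 with hB
  set M := (1 - 4 * (u * (1 - u)))⁻¹
  have hM : 0 ≤ M := inv_nonneg.2 (by linarith)
  have hE (j : ℕ) : (1 - u) * B (b + 1) - B b =
      u ^ j * ((1 - u) * B (b + j + 1) - B (b + j)) := by
    induction j with
    | zero => simp
    | succ j ih =>
      rw [ih]
      have := diagonalBinomialSeries_zero_succ ht ht' (b + j)
      rw [← hB] at this
      rw [← add_assoc, pow_succ]
      linear_combination u ^ j * this
  have hbound (j : ℕ) : |(1 - u) * B (b + 1) - B b| ≤ 2 ^ (b + 1) * M * (2 * u) ^ j := by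
    have h0 (i : ℕ) : 0 ≤ B i := diagonalBinomialSeries_nonneg ht 0 i
    have h1 (i : ℕ) : B i ≤ 2 ^ i * M := by
      simpa using diagonalBinomialSeries_le ht ht' 0 i
    have h2 : |(1 - u) * B (b + j + 1) - B (b + j)| ≤ 2 ^ (b + j + 1) * M := by
      have := h0 (b + j + 1)
      have := h0 (b + j)
      have := h1 (b + j + 1)
      have := h1 (b + j)
      have : 0 ≤ 2 ^ (b + j) * M := by positivity
      rw [pow_succ] at *
      rw [abs_le]
      constructor <;> nlinarith
    rw [hE j, abs_mul, abs_of_nonneg (pow_nonneg hu j)]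
    calc _ ≤ u ^ j * (2 ^ (b + j + 1) * M) := by gcongr
      _ = _ := by rw [mul_pow]; ring
  have hlim : Filter.Tendsto (fun j : ℕ => 2 ^ (b + 1) * M * (2 * u) ^ j) Filter.atTop (nhds 0) := by
    simpa using (tendsto_pow_atTop_nhds_zero_of_lt_one (by positivity) hu').const_mul
      (2 ^ (b + 1) * M)
  have := ge_of_tendsto' hlim hbound
  exact sub_eq_zero.1 (abs_nonpos_iff.1 this)

theorem diagonalBinomialSeries_zero_eq (hu : 0 ≤ u) (hu' : 2 * u < 1) (b : ℕ) :
    (1 - 2 * u) * diagonalBinomialSeries (u * (1 - u)) 0 b = 1 / (1 - u) ^ b := by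
  have hne : 1 - u ≠ 0 := by linarith
  induction b with
  | zero =>
    have h := diagonalBinomialSeries_zero_zero (mul_nonneg hu (by linarith))
      (show 4 * (u * (1 - u)) < 1 by nlinarith)
    have h1 := one_sub_mul_diagonalBinomialSeries hu hu' 0
    simp only [zero_add] at h1
    simp only [pow_zero, div_one]
    linear_combination h + 2 * u * h1
  | succ b ih =>
    rw [pow_succ, ← div_div, ← ih, ← one_sub_mul_diagonalBinomialSeries hu hu' b]
    field_simp

theorem diagonalBinomialSeries_eq (hu : 0 ≤ u) (hu' : 2 * u < 1) (a b : ℕ) (hab : a + b ≠ 0) :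
    (1 - 2 * u) * diagonalBinomialSeries (u * (1 - u)) a b =
      shiftedBinomialSeries u a b + shiftedBinomialSeries u b a := by
  have hzero (b : ℕ) : (1 - 2 * u) * diagonalBinomialSeries (u * (1 - u)) 0 (b + 1) =
      shiftedBinomialSeries u 0 (b + 1) + shiftedBinomialSeries u (b + 1) 0 := by
    rw [diagonalBinomialSeries_zero_eq hu hu', shiftedBinomialSeries_succ_zero,
      shiftedBinomialSeries_zero_succ hu hu', add_zero]
  induction a generalizing b with
  | zero =>
    obtain ⟨b, rfl⟩ := Nat.exists_eq_succ_of_ne_zero (show b ≠ 0 by lia)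
    exact hzero b
  | succ a iha =>
    induction b with
    | zero => rw [diagonalBinomialSeries_comm, hzero, add_comm]
    | succ b ihb =>
      rw [diagonalBinomialSeries_pascal (mul_nonneg hu (by linarith))
          (show 4 * (u * (1 - u)) < 1 by nlinarith),
        shiftedBinomialSeries_pascal hu hu', shiftedBinomialSeries_pascal hu hu']
      linear_combination iha (b + 1) (by lia) + ihb (by lia)

end QuadraticParameter

theorem choose_mul_hyp3F2_eq (a b : ℕ) (x : ℝ) :
    ((a + b).choose a : ℝ) * hyp3F2 1 (((a : ℝ) + b) / 2 + 1) (((a : ℝ) + b + 1) / 2)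
      ((a : ℝ) + 1) ((b : ℝ) + 1) x = diagonalBinomialSeries (x / 4) a b := by
  unfold hyp3F2 diagonalBinomialSeries
  rw [← tsum_mul_left]
  refine tsum_congr fun n => ?_
  have h := ascPochhammer_eval_duplication (a + b) n
  have ha := ascPochhammer_eval_cast_add_one_mul_factorial a n
  have hb := ascPochhammer_eval_cast_add_one_mul_factorial b n
  have hapos : 0 < (ascPochhammer ℝ n).eval ((a : ℝ) + 1) := ascPochhammer_pos n _ (by positivity)
  have hbpos : 0 < (ascPochhammer ℝ n).eval ((b : ℝ) + 1) := ascPochhammer_pos n _ (by positivity)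
  rw [ascPochhammer_eval_one, Nat.cast_add_choose,
    show a + b + 2 * n = (a + n) + (b + n) by ring, Nat.cast_add_choose,
    show a + n + (b + n) = a + b + 2 * n by ring, ← h, ← ha, ← hb, div_pow]
  push_cast
  field_simp

theorem choose_mul_hyp2F1_eq (a b : ℕ) (hb : 0 < b) (u : ℝ) :
    ((a + b).choose a : ℝ) * (b * hyp2F1 1 ((a : ℝ) + b) ((a : ℝ) + 1) u) =
      ((a : ℝ) + b) * shiftedBinomialSeries u a b := by
  obtain ⟨b, rfl⟩ := Nat.exists_eq_succ_of_ne_zero hb.ne'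
  unfold hyp2F1 shiftedBinomialSeries
  rw [← tsum_mul_left, ← tsum_mul_left, ← tsum_mul_left]
  refine tsum_congr fun n => ?_
  have h := ascPochhammer_eval_cast_add_one_mul_factorial (a + b) n
  have ha := ascPochhammer_eval_cast_add_one_mul_factorial a n
  have hapos : 0 < (ascPochhammer ℝ n).eval ((a : ℝ) + 1) := ascPochhammer_pos n _ (by positivity)
  rw [ascPochhammer_eval_one, Nat.cast_add_choose, Nat.succ_eq_add_one,
    show a + (b + 1) + n - 1 = (a + n) + b by lia, Nat.cast_add_choose,
    show a + n + b = a + b + n by ring, ← h, ← ha, ← add_assoc, Nat.factorial_succ,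
    Nat.factorial_succ]
  push_cast
  rw [← add_assoc]
  field_simp

theorem stmt4 (k1 k2 : ℕ) (hk1 : 0 < k1) (hk2 : 0 < k2) (x : ℝ) (hx0 : 0 < x) (hx1 : x < 1) :
    hyp3F2 1 (((k1 : ℝ) + (k2 : ℝ)) / 2 + 1) (((k1 : ℝ) + (k2 : ℝ) + 1) / 2)
        ((k1 : ℝ) + 1) ((k2 : ℝ) + 1) x =
      1 / (((k1 : ℝ) + (k2 : ℝ)) * Real.sqrt (1 - x)) *
        ((k2 : ℝ) * hyp2F1 1 ((k1 : ℝ) + (k2 : ℝ)) ((k1 : ℝ) + 1) (1 / 2 - Real.sqrt (1 - x) / 2) +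
         (k1 : ℝ) * hyp2F1 1 ((k1 : ℝ) + (k2 : ℝ)) ((k2 : ℝ) + 1) (1 / 2 - Real.sqrt (1 - x) / 2)) := by
  set s := Real.sqrt (1 - x) with hs
  have hs0 : 0 < s := Real.sqrt_pos.2 (by linarith)
  have hsq : s ^ 2 = 1 - x := Real.sq_sqrt (by linarith)
  have hs1 : s < 1 := by nlinarith
  have hmain := diagonalBinomialSeries_eq (u := 1 / 2 - s / 2) (by linarith) (by linarith) k1 k2
    (by lia)
  rw [show (1 / 2 - s / 2) * (1 - (1 / 2 - s / 2)) = x / 4 by linear_combination -hsq / 4,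
    show 1 - 2 * (1 / 2 - s / 2) = s by ring, ← choose_mul_hyp3F2_eq] at hmain
  have h1 := choose_mul_hyp2F1_eq k1 k2 hk2 (1 / 2 - s / 2)
  have h2 := choose_mul_hyp2F1_eq k2 k1 hk1 (1 / 2 - s / 2)
  rw [add_comm k2 k1, add_comm (k2 : ℝ) k1, ← Nat.choose_symm_add] at h2
  have hc : ((k1 + k2).choose k1 : ℝ) ≠ 0 :=
    Nat.cast_ne_zero.2 (Nat.choose_pos (Nat.le_add_right _ _)).ne'
  have hk : (k1 : ℝ) + k2 ≠ 0 := by positivity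
  rw [one_div_mul_eq_div, eq_div_iff (mul_ne_zero hk hs0.ne')]
  apply mul_left_cancel₀ hc
  linear_combination ((k1 : ℝ) + k2) * hmain - h1 - h2
end

section
/- For all integers k₁ ≥ k₂ ≥ 1 and all real x with 0 < x < 1, the following identity holds: ₃F₂(1, (k₁+k₂)/2 + 1, (k₁+k₂+1)/2; k₁+1, k₂+1; x) = (k₁!·k₂!/(k₁+k₂)!) · (2^{k₁+k₂}/x^{k₂}) · (1+√(1−x))^{k₂−k₁}/√(1−x) − (4k₁k₂/((k₁+k₂−1)(k₁+k₂)x)) · ₃F₂(1, −k₂+1, −k₁+1; −(k₁+k₂)/2 + 1, (−k₁−k₂+3)/2; 1/x), where the second ₃F₂ is the terminating sum Σ_{m=0}^{k₂−1} (1)ₘ(−k₂+1)ₘ(−k₁+1)ₘ / ((−(k₁+k₂)/2+1)ₘ ((−k₁−k₂+3)/2)ₘ m!) · x^{−m} (well-defined since k₁ ≥ k₂ guarantees no denominator Pochhammer vanishes in this range). -/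
/-- The terminating hypergeometric sum
₃F₂(1, −k₂+1, −k₁+1; −(k₁+k₂)/2 + 1, (−k₁−k₂+3)/2; 1/x)
= Σ_{m=0}^{k₂−1} (1)ₘ(−k₂+1)ₘ(−k₁+1)ₘ / ((−(k₁+k₂)/2+1)ₘ ((−k₁−k₂+3)/2)ₘ m!) · x^{−m}. -/
noncomputable def hyp3F2term (k1 k2 : ℕ) (x : ℝ) : ℝ :=
  ∑ m ∈ Finset.range k2,
    ((ascPochhammer ℝ m).eval 1 * (ascPochhammer ℝ m).eval (-(k2 : ℝ) + 1) *
        (ascPochhammer ℝ m).eval (-(k1 : ℝ) + 1)) /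
      ((ascPochhammer ℝ m).eval (-((k1 : ℝ) + (k2 : ℝ)) / 2 + 1) *
        (ascPochhammer ℝ m).eval ((-(k1 : ℝ) - (k2 : ℝ) + 3) / 2) * (m.factorial : ℝ)) *
      (1 / x) ^ m

/-- The generating function `∑ m, C(r + 2m, m) (x / 4) ^ m`. -/
noncomputable def shiftedCentralGF (x : ℝ) (r : ℕ) : ℝ :=
  ∑' m : ℕ, ((r + 2 * m).choose m : ℝ) * (x / 4) ^ m

lemma choose_mul_pow_le_s5 {x : ℝ} (hx0 : 0 ≤ x) (r m : ℕ) :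
    ((r + 2 * m).choose m : ℝ) * (x / 4) ^ m ≤ 2 ^ r * x ^ m := by
  have h : ((r + 2 * m).choose m : ℝ) ≤ 2 ^ (r + 2 * m) := mod_cast Nat.choose_le_two_pow _ _
  calc ((r + 2 * m).choose m : ℝ) * (x / 4) ^ m
      ≤ 2 ^ (r + 2 * m) * (x / 4) ^ m := by gcongr
    _ = 2 ^ r * x ^ m := by
      rw [pow_add, pow_mul, mul_assoc, ← mul_pow]
      congr 2
      ring

lemma summable_shiftedCentral {x : ℝ} (hx0 : 0 ≤ x) (hx1 : x < 1) (r : ℕ) :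
    Summable fun m : ℕ => ((r + 2 * m).choose m : ℝ) * (x / 4) ^ m :=
  .of_nonneg_of_le (fun _ => by positivity) (choose_mul_pow_le_s5 hx0 r)
    ((summable_geometric_of_lt_one hx0 hx1).mul_left _)

lemma shiftedCentralGF_nonneg {x : ℝ} (hx0 : 0 ≤ x) (r : ℕ) : 0 ≤ shiftedCentralGF x r :=
  tsum_nonneg fun _ => by positivity

lemma shiftedCentralGF_le {x : ℝ} (hx0 : 0 ≤ x) (hx1 : x < 1) (r : ℕ) :
    shiftedCentralGF x r ≤ 2 ^ r * (1 - x)⁻¹ := by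
  rw [← tsum_geometric_of_lt_one hx0 hx1, ← tsum_mul_left]
  exact (summable_shiftedCentral hx0 hx1 r).tsum_le_tsum (choose_mul_pow_le_s5 hx0 r)
    ((summable_geometric_of_lt_one hx0 hx1).mul_left _)

lemma shiftedCentralGF_succ {x : ℝ} (hx0 : 0 ≤ x) (hx1 : x < 1) (r : ℕ) :
    shiftedCentralGF x (r + 1) = shiftedCentralGF x r + x / 4 * shiftedCentralGF x (r + 2) := by
  have h := summable_shiftedCentral hx0 hx1
  unfold shiftedCentralGF
  rw [(h (r + 1)).tsum_eq_zero_add, (h r).tsum_eq_zero_add, ← tsum_mul_left, add_assoc (_ * _),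
    ← ((summable_nat_add_iff 1).2 (h r)).tsum_add ((h (r + 2)).mul_left (x / 4))]
  congr 1
  · simp
  · refine tsum_congr fun m => ?_
    rw [show r + 1 + 2 * (m + 1) = r + 2 * (m + 1) + 1 by ring, Nat.choose_succ_succ,
      show r + 2 * (m + 1) = r + 2 + 2 * m by ring]
    push_cast
    ring

lemma shiftedCentralGF_zero {x : ℝ} (hx0 : 0 ≤ x) (hx1 : x < 1) :
    shiftedCentralGF x 0 = 1 + x / 2 * shiftedCentralGF x 1 := by
  have h := summable_shiftedCentral hx0 hx1
  unfold shiftedCentralGF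
  rw [(h 0).tsum_eq_zero_add, ← tsum_mul_left]
  congr 1
  · simp
  · refine tsum_congr fun m => ?_
    rw [show 0 + 2 * (m + 1) = 2 * m + 1 + 1 by ring, Nat.choose_succ_succ,
      ← Nat.choose_symm_half m, show 1 + 2 * m = 2 * m + 1 by ring]
    push_cast
    rw [Nat.choose_symm_half]
    ring

lemma shiftedCentralGF_succ_eq_mul {x s : ℝ} (hx0 : 0 < x) (hx1 : x < 1) (hs0 : 0 < s)
    (hs : s ^ 2 = 1 - x) (r : ℕ) :
    shiftedCentralGF x (r + 1) = 2 / (1 + s) * shiftedCentralGF x r := by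
  set H : ℕ → ℝ := fun r => (1 + s) / 2 * shiftedCentralGF x (r + 1) - shiftedCentralGF x r with hH
  have hs1 : s < 1 := by nlinarith
  have step (r : ℕ) : H r = (1 - s) / 2 * H (r + 1) := by
    have h := shiftedCentralGF_succ hx0.le hx1 r
    simp only [hH]
    have hx : x = (1 - s) * (1 + s) := by linarith
    linear_combination h + shiftedCentralGF x (r + 2) / 4 * hx
  have iter (r n : ℕ) : H r = ((1 - s) / 2) ^ n * H (r + n) := by
    induction n with
    | zero => simp
    | succ n ih => rw [ih, step (r + n)]; ring_nf
  have bound (r : ℕ) : |H r| ≤ 2 ^ r * (2 * (1 - x)⁻¹) := by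
    have h1 := shiftedCentralGF_le hx0.le hx1 r
    have h2 := shiftedCentralGF_le hx0.le hx1 (r + 1)
    have h3 := shiftedCentralGF_nonneg hx0.le r
    have h4 := shiftedCentralGF_nonneg hx0.le (r + 1)
    rw [pow_succ] at h2
    rw [abs_le]
    constructor <;> simp only [hH] <;> nlinarith
  have bound' (n : ℕ) : |H r| ≤ (2 ^ r * (2 * (1 - x)⁻¹)) * (1 - s) ^ n := by
    have h0 : 0 ≤ ((1 - s) / 2) ^ n := pow_nonneg (by linarith) n
    rw [iter r n, abs_mul, abs_of_nonneg h0]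
    calc ((1 - s) / 2) ^ n * |H (r + n)|
        ≤ ((1 - s) / 2) ^ n * (2 ^ (r + n) * (2 * (1 - x)⁻¹)) := by gcongr; exact bound _
      _ = _ := by rw [div_pow, pow_add]; field_simp
  have lim : Filter.Tendsto (fun n : ℕ => (2 ^ r * (2 * (1 - x)⁻¹)) * (1 - s) ^ n) Filter.atTop
      (nhds 0) := by
    simpa using (tendsto_pow_atTop_nhds_zero_of_lt_one (by linarith : 0 ≤ 1 - s)
      (by linarith)).const_mul (2 ^ r * (2 * (1 - x)⁻¹))
  have hz : H r = 0 := abs_nonpos_iff.1 (ge_of_tendsto' lim bound')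
  simp only [hH] at hz
  field_simp
  linear_combination 2 * hz

lemma shiftedCentralGF_eq {x s : ℝ} (hx0 : 0 < x) (hx1 : x < 1) (hs0 : 0 < s)
    (hs : s ^ 2 = 1 - x) (r : ℕ) :
    shiftedCentralGF x r = (2 / (1 + s)) ^ r / s := by
  induction r with
  | zero =>
    have h0 := shiftedCentralGF_zero hx0.le hx1
    rw [shiftedCentralGF_succ_eq_mul hx0 hx1 hs0 hs 0] at h0
    have hx : x = (1 - s) * (1 + s) := by linarith
    have h1 : x / 2 * (2 / (1 + s) * shiftedCentralGF x 0) = (1 - s) * shiftedCentralGF x 0 := by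
      nth_rewrite 1 [hx]
      field_simp
    rw [h1] at h0
    rw [pow_zero, eq_div_iff hs0.ne']
    linear_combination h0
  | succ r ih => rw [shiftedCentralGF_succ_eq_mul hx0 hx1 hs0 hs, ih]; ring

lemma ascPochhammer_half_mul (N n : ℕ) :
    (N.factorial : ℝ) * 4 ^ n * ((ascPochhammer ℝ n).eval ((N : ℝ) / 2 + 1) *
      (ascPochhammer ℝ n).eval (((N : ℝ) + 1) / 2)) = ((N + 2 * n).factorial : ℝ) := by
  induction n with
  | zero => simp
  | succ n ih =>
    rw [ascPochhammer_succ_eval, ascPochhammer_succ_eval,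
      show N + 2 * (n + 1) = N + 2 * n + 1 + 1 by ring, Nat.factorial_succ, Nat.factorial_succ]
    push_cast
    rw [← ih]
    ring

lemma ascPochhammer_neg_half_mul (N m : ℕ) (h : 2 * m ≤ N) :
    4 ^ m * ((N - 2 * m).factorial : ℝ) * ((ascPochhammer ℝ m).eval (-(N : ℝ) / 2) *
      (ascPochhammer ℝ m).eval ((1 - (N : ℝ)) / 2)) = (N.factorial : ℝ) := by
  induction m with
  | zero => simp
  | succ m ih =>
    rw [← ih (by lia), ascPochhammer_succ_eval, ascPochhammer_succ_eval]
    obtain ⟨t, rfl⟩ := Nat.exists_eq_add_of_le h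
    rw [show 2 * (m + 1) + t - 2 * m = t + 1 + 1 by lia, Nat.add_sub_cancel_left,
      Nat.factorial_succ, Nat.factorial_succ]
    push_cast
    ring

lemma ascPochhammer_neg_natCast_mul (k m : ℕ) (h : m ≤ k) :
    ((k - m).factorial : ℝ) * (ascPochhammer ℝ m).eval (-(k : ℝ)) = (-1) ^ m * k.factorial := by
  induction m with
  | zero => simp
  | succ m ih =>
    rw [pow_succ, mul_right_comm, ← ih (by lia), ascPochhammer_succ_eval]
    obtain ⟨t, rfl⟩ := Nat.exists_eq_add_of_le h
    rw [show m + 1 + t - m = t + 1 by lia, Nat.add_sub_cancel_left, Nat.factorial_succ]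
    push_cast
    ring

lemma hyp3F2_eq_tsum_choose (k1 k2 : ℕ) (x : ℝ) :
    hyp3F2 1 (((k1 : ℝ) + (k2 : ℝ)) / 2 + 1) (((k1 : ℝ) + (k2 : ℝ) + 1) / 2)
        ((k1 : ℝ) + 1) ((k2 : ℝ) + 1) x =
      ((k1.factorial : ℝ) * (k2.factorial : ℝ) / ((k1 + k2).factorial : ℝ)) *
        ∑' n : ℕ, ((k1 + k2 + 2 * n).choose (k2 + n) : ℝ) * (x / 4) ^ n := by
  rw [hyp3F2, ← tsum_mul_left]
  refine tsum_congr fun n => ?_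
  have h := ascPochhammer_half_mul (k1 + k2) n
  have h1 := factorial_mul_ascPochhammer ℝ k1 n
  have h2 := factorial_mul_ascPochhammer ℝ k2 n
  have p1 := ascPochhammer_pos n ((k1 : ℝ) + 1) (by positivity)
  have p2 := ascPochhammer_pos n ((k2 : ℝ) + 1) (by positivity)
  push_cast at h
  rw [Nat.cast_choose ℝ (show k2 + n ≤ k1 + k2 + 2 * n by lia),
    show k1 + k2 + 2 * n - (k2 + n) = k1 + n by lia, ascPochhammer_eval_one, ← h, ← h1, ← h2,
    div_pow]
  field_simp

lemma hyp3F2term_eq_sum_choose (k1 k2 : ℕ) (hk1 : 1 ≤ k1) (hk2 : 1 ≤ k2) (hk12 : k2 ≤ k1) {x : ℝ}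
    (hx0 : 0 < x) :
    4 * (k1 : ℝ) * (k2 : ℝ) / (((k1 : ℝ) + (k2 : ℝ) - 1) * ((k1 : ℝ) + (k2 : ℝ)) * x) *
        hyp3F2term k1 k2 x =
      ((k1.factorial : ℝ) * (k2.factorial : ℝ) / ((k1 + k2).factorial : ℝ)) *
        ∑ m ∈ Finset.range k2,
          ((k1 + k2 - 2 - 2 * m).choose (k2 - 1 - m) : ℝ) * (4 / x) ^ (m + 1) := by
  obtain ⟨a, rfl⟩ := Nat.exists_eq_add_of_le' hk1
  obtain ⟨b, rfl⟩ := Nat.exists_eq_add_of_le' hk2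
  rw [hyp3F2term, Finset.mul_sum, Finset.mul_sum]
  refine Finset.sum_congr rfl fun m hm => ?_
  have hmb : m ≤ b := by rw [Finset.mem_range] at hm; lia
  have hma : m ≤ a := by lia
  have ha := ascPochhammer_neg_natCast_mul a m hma
  have hb := ascPochhammer_neg_natCast_mul b m hmb
  have hab := ascPochhammer_neg_half_mul (a + b) m (by lia)
  rw [show a + 1 + (b + 1) - 2 - 2 * m = a + b - 2 * m by lia,
    show b + 1 - 1 - m = b - m by lia,
    Nat.cast_choose ℝ (show b - m ≤ a + b - 2 * m by lia),
    show a + b - 2 * m - (b - m) = a - m by lia, ascPochhammer_eval_one,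
    show a + 1 + (b + 1) = a + b + 1 + 1 by lia]
  simp only [Nat.factorial_succ]
  push_cast at hab ⊢
  rw [show -((b : ℝ) + 1) + 1 = -b by ring, show -((a : ℝ) + 1) + 1 = -a by ring,
    show -((a : ℝ) + 1 + (b + 1)) / 2 + 1 = -(a + b) / 2 by ring,
    show (-((a : ℝ) + 1) - (b + 1) + 3) / 2 = (1 - (a + b)) / 2 by ring,
    show (a : ℝ) + 1 + (b + 1) - 1 = a + b + 1 by ring,
    show (a : ℝ) + 1 + (b + 1) = a + b + 1 + 1 by ring]
  have fab : ((a + b).factorial : ℝ) ≠ 0 := by positivity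
  have hne : (ascPochhammer ℝ m).eval (-((a : ℝ) + b) / 2) *
      (ascPochhammer ℝ m).eval ((1 - ((a : ℝ) + b)) / 2) ≠ 0 := by
    intro h0
    rw [h0, mul_zero] at hab
    exact fab hab.symm
  have sgn : ((-1 : ℝ) ^ m) * (-1) ^ m = 1 := by rw [← mul_pow]; simp
  have hab' : (ascPochhammer ℝ m).eval (-(a : ℝ)) * (ascPochhammer ℝ m).eval (-(b : ℝ)) =
      a.factorial * b.factorial / ((a - m).factorial * (b - m).factorial) := by
    rw [eq_div_iff (by positivity)]
    linear_combination (((b - m).factorial : ℝ) * (ascPochhammer ℝ m).eval (-(b : ℝ))) * ha +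
      ((-1) ^ m * (a.factorial : ℝ)) * hb + (a.factorial * b.factorial : ℝ) * sgn
  rw [← hab, mul_assoc (m.factorial : ℝ), mul_comm ((ascPochhammer ℝ m).eval (-(b : ℝ))), hab']
  generalize (ascPochhammer ℝ m).eval (-((a : ℝ) + b) / 2) *
      (ascPochhammer ℝ m).eval ((1 - ((a : ℝ) + b)) / 2) = P at *
  rw [div_pow, div_pow, one_pow]
  field_simp
  ring

lemma tsum_choose_eq (d k : ℕ) {x : ℝ} (hx0 : 0 < x) (hx1 : x < 1) :
    ∑' n : ℕ, ((k + d + k + 2 * n).choose (k + n) : ℝ) * (x / 4) ^ n =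
      (4 / x) ^ k * shiftedCentralGF x d -
        ∑ m ∈ Finset.range k,
          ((k + d + k - 2 - 2 * m).choose (k - 1 - m) : ℝ) * (4 / x) ^ (m + 1) := by
  have hy : 4 / x * (x / 4) = 1 := by field_simp
  have hpow (n : ℕ) : (4 / x) ^ n * (x / 4) ^ n = 1 := by rw [← mul_pow, hy, one_pow]
  rw [shiftedCentralGF, ← (summable_shiftedCentral hx0.le hx1 d).sum_add_tsum_nat_add k, mul_add,
    ← Finset.sum_range_reflect, Finset.mul_sum, ← tsum_mul_left]
  have hfin : ∑ i ∈ Finset.range k, (4 / x) ^ k *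
        (((d + 2 * (k - 1 - i)).choose (k - 1 - i) : ℝ) * (x / 4) ^ (k - 1 - i)) =
      ∑ m ∈ Finset.range k,
        ((k + d + k - 2 - 2 * m).choose (k - 1 - m) : ℝ) * (4 / x) ^ (m + 1) := by
    refine Finset.sum_congr rfl fun m hm => ?_
    rw [Finset.mem_range] at hm
    obtain ⟨t, rfl⟩ := Nat.exists_eq_add_of_le (show m + 1 ≤ k by lia)
    rw [show m + 1 + t - 1 - m = t by lia,
      show m + 1 + t + d + (m + 1 + t) - 2 - 2 * m = d + 2 * t by lia, pow_add]
    linear_combination ((d + 2 * t).choose t : ℝ) * (4 / x) ^ (m + 1) * hpow t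
  rw [hfin, add_sub_cancel_left]
  refine tsum_congr fun n => ?_
  rw [show k + d + k + 2 * n = d + 2 * (n + k) by ring, add_comm k n, pow_add]
  linear_combination (-((d + 2 * (n + k)).choose (n + k) : ℝ) * (x / 4) ^ n) * hpow k

theorem stmt5 (k1 k2 : ℕ) (hk2 : 1 ≤ k2) (hk12 : k2 ≤ k1) (x : ℝ) (hx0 : 0 < x) (hx1 : x < 1) :
    hyp3F2 1 (((k1 : ℝ) + (k2 : ℝ)) / 2 + 1) (((k1 : ℝ) + (k2 : ℝ) + 1) / 2)
        ((k1 : ℝ) + 1) ((k2 : ℝ) + 1) x =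
      ((k1.factorial : ℝ) * (k2.factorial : ℝ) / ((k1 + k2).factorial : ℝ)) *
        (2 ^ (k1 + k2) / x ^ k2) *
        (1 + Real.sqrt (1 - x)) ^ ((k2 : ℤ) - (k1 : ℤ)) / Real.sqrt (1 - x) -
      4 * (k1 : ℝ) * (k2 : ℝ) / (((k1 : ℝ) + (k2 : ℝ) - 1) * ((k1 : ℝ) + (k2 : ℝ)) * x) *
        hyp3F2term k1 k2 x := by
  have hs0 : 0 < Real.sqrt (1 - x) := Real.sqrt_pos.2 (by linarith)
  have hs : Real.sqrt (1 - x) ^ 2 = 1 - x := Real.sq_sqrt (by linarith)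
  rw [hyp3F2term_eq_sum_choose k1 k2 (hk2.trans hk12) hk2 hk12 hx0, hyp3F2_eq_tsum_choose]
  obtain ⟨d, rfl⟩ := Nat.exists_eq_add_of_le hk12
  rw [tsum_choose_eq d k2 hx0 hx1, shiftedCentralGF_eq hx0 hx1 hs0 hs, mul_sub]
  congr 1
  rw [show (k2 : ℤ) - ((k2 + d : ℕ) : ℤ) = -(d : ℤ) by push_cast; ring, zpow_neg, zpow_natCast,
    div_pow, div_pow, show (4 : ℝ) = 2 ^ 2 by norm_num, ← pow_mul,
    show k2 + d + k2 = 2 * k2 + d by ring, pow_add]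
  field_simp
end

section
/- Let 0 < β ≤ 1 and let x be a real number with 0 ≤ x and (1+β)²x/(4β) < 1. Then, as the real parameter t tends to +∞, ₃F₂(1, t(1+β)/2 + 1, t(1+β)/2 + 1/2; t+1, tβ+1; x) converges to 1/(1 − (1+β)²x/(4β)). -/
open Filter

theorem hyp3F2_one_term_succ (b c d e x : ℝ) (n : ℕ) :
    ((ascPochhammer ℝ (n + 1)).eval 1 * (ascPochhammer ℝ (n + 1)).eval b *
        (ascPochhammer ℝ (n + 1)).eval c) /
      ((ascPochhammer ℝ (n + 1)).eval d * (ascPochhammer ℝ (n + 1)).eval e *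
        ((n + 1).factorial : ℝ)) * x ^ (n + 1) =
    ((ascPochhammer ℝ n).eval 1 * (ascPochhammer ℝ n).eval b * (ascPochhammer ℝ n).eval c) /
      ((ascPochhammer ℝ n).eval d * (ascPochhammer ℝ n).eval e * (n.factorial : ℝ)) * x ^ n *
      ((b + n) / (d + n) * ((c + n) / (e + n)) * x) := by
  have h : ((n : ℝ) + 1) / (n + 1) = 1 := div_self (by positivity)
  simp only [ascPochhammer_succ_eval, Nat.factorial_succ, Nat.cast_mul, Nat.cast_add,
    Nat.cast_one, pow_succ, add_comm (1 : ℝ)]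
  generalize (n : ℝ) + 1 = m at h ⊢
  generalize b + (n : ℝ) = b', c + (n : ℝ) = c', d + (n : ℝ) = d', e + (n : ℝ) = e'
  linear_combination
    ((ascPochhammer ℝ n).eval 1 * (ascPochhammer ℝ n).eval b * (ascPochhammer ℝ n).eval c) /
      ((ascPochhammer ℝ n).eval d * (ascPochhammer ℝ n).eval e * (n.factorial : ℝ)) * x ^ n *
      (b' / d' * (c' / e') * x) * h

theorem tendsto_affine_div_affine_atTop (a b d : ℝ) {c : ℝ} (hc : c ≠ 0) :
    Tendsto (fun t : ℝ => (t * a + b) / (t * c + d)) atTop (nhds (a / c)) := by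
  have key (u v : ℝ) : Tendsto (fun t : ℝ => u + v * t⁻¹) atTop (nhds u) := by
    simpa using (tendsto_inv_atTop_zero.const_mul v).const_add u
  refine ((key a b).div (key c d) hc).congr' ?_
  filter_upwards [eventually_gt_atTop 0] with t ht
  simp only [Pi.div_apply]
  rw [← mul_div_mul_left _ _ ht.ne']
  congr 1 <;> field_simp

theorem hyp3F2_term_ratio_le {β t : ℝ} (hβ : 0 < β) (ht : 0 ≤ t) (n : ℕ) :
    (t * (1 + β) / 2 + 1 + n) / (t + 1 + n) * ((t * (1 + β) / 2 + 1 / 2 + n) / (t * β + 1 + n)) ≤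
      (1 + β) ^ 2 / (4 * β) := by
  have hy : 1 ≤ (1 + β) ^ 2 / (4 * β) := by
    rw [one_le_div (by positivity)]
    nlinarith [sq_nonneg (1 - β)]
  have hyβ : (1 + β) ^ 2 / (4 * β) * β = (1 + β) ^ 2 / 4 := by field_simp
  generalize (1 + β) ^ 2 / (4 * β) = y at hy hyβ ⊢
  have hm : (0 : ℝ) ≤ n := n.cast_nonneg
  rw [div_mul_div_comm, div_le_iff₀ (by positivity)]
  have h1 : 0 ≤ (y - 1) * (t * (1 + β) * (1 + n) + (1 + n) ^ 2) :=
    mul_nonneg (by linarith) (by positivity)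
  have h2 : 0 ≤ t * (1 + β) / 2 + 1 + n := by positivity
  linear_combination h1 + h2 / 2 - t ^ 2 * hyβ

theorem stmt12 (β : ℝ) (hβ0 : 0 < β) (hβ1 : β ≤ 1) (x : ℝ)
    (hx0 : 0 ≤ x) (hx : (1 + β) ^ 2 * x / (4 * β) < 1) :
    Tendsto
      (fun t : ℝ =>
        hyp3F2 1 (t * (1 + β) / 2 + 1) (t * (1 + β) / 2 + 1 / 2) (t + 1) (t * β + 1) x)
      atTop (nhds (1 / (1 - (1 + β) ^ 2 * x / (4 * β)))) := by
  have hr : (1 + β) ^ 2 * x / (4 * β) = (1 + β) ^ 2 / (4 * β) * x := by ring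
  rw [hr] at hx ⊢
  have hr0 : 0 ≤ (1 + β) ^ 2 / (4 * β) * x := by positivity
  rw [one_div (1 - _), ← tsum_geometric_of_lt_one hr0 hx]
  unfold hyp3F2
  refine tendsto_tsum_of_dominated_convergence (summable_geometric_of_lt_one hr0 hx) ?_ ?_
  · intro n
    induction n with
    | zero => simp
    | succ n ih =>
      simp only [hyp3F2_one_term_succ]
      rw [pow_succ]
      refine ih.mul (Tendsto.mul_const x ?_)
      have h1 := (tendsto_affine_div_affine_atTop ((1 + β) / 2) (1 + n) (1 + n) one_ne_zero).mul
        (tendsto_affine_div_affine_atTop ((1 + β) / 2) (1 / 2 + n) (1 + n) hβ0.ne')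
      convert h1 using 2
      · ring
      · field_simp
        ring
  · filter_upwards [eventually_ge_atTop 0] with t ht n
    induction n with
    | zero => simp
    | succ n ih =>
      rw [hyp3F2_one_term_succ, norm_mul, pow_succ]
      refine mul_le_mul ih ?_ (norm_nonneg _) (by positivity)
      rw [Real.norm_of_nonneg (by positivity)]
      exact mul_le_mul_of_nonneg_right (hyp3F2_term_ratio_le hβ0 ht n) hx0
end

section
/- Let 0 < β < 1 and let x be a real number with 0 ≤ x < 1 and (1+β)²x/(4β) > 1. Then, as the real parameter t tends to +∞, the quantity (β/((1+β)√(1−x))) · [ ₂F₁(1, (1+β)t; t+1; 1/2 − √(1−x)/2) − ₂F₁(1, (1+β)t; t+1; 1/2 + √(1−x)/2) ] converges to −1/((1+β)²x/(4β) − 1). -/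
open Filter

theorem hyp2F1_one_left (b d x : ℝ) :
    hyp2F1 1 b d x =
      ∑' n : ℕ, (ascPochhammer ℝ n).eval b / (ascPochhammer ℝ n).eval d * x ^ n := by
  unfold hyp2F1
  refine tsum_congr fun n => ?_
  have hn : (n.factorial : ℝ) ≠ 0 := by exact_mod_cast n.factorial_ne_zero
  rw [ascPochhammer_eval_one, mul_comm (n.factorial : ℝ), mul_div_mul_right _ _ hn]

theorem ascPochhammer_eval_div_succ (n : ℕ) (b d : ℝ) :
    (ascPochhammer ℝ (n + 1)).eval b / (ascPochhammer ℝ (n + 1)).eval d =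
      (ascPochhammer ℝ n).eval b / (ascPochhammer ℝ n).eval d * ((b + n) / (d + n)) := by
  rw [ascPochhammer_succ_eval, ascPochhammer_succ_eval, mul_div_mul_comm]

theorem tendsto_linear_div_linear (c k : ℝ) :
    Tendsto (fun t : ℝ => (c * t + k) / (t + 1 + k)) atTop (nhds c) := by
  have hden : Tendsto (fun t : ℝ => t + 1 + k) atTop atTop :=
    tendsto_atTop_add_const_right _ _ (tendsto_atTop_add_const_right _ _ tendsto_id)
  have h : Tendsto (fun t : ℝ => c + (k - c * (1 + k)) / (t + 1 + k)) atTop (nhds (c + 0)) :=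
    tendsto_const_nhds.add (tendsto_const_nhds.div_atTop hden)
  rw [add_zero] at h
  refine h.congr' ?_
  filter_upwards [hden.eventually_gt_atTop 0] with t ht
  field_simp
  ring

theorem tendsto_ascPochhammer_ratio (c : ℝ) (n : ℕ) :
    Tendsto (fun t : ℝ => (ascPochhammer ℝ n).eval (c * t) / (ascPochhammer ℝ n).eval (t + 1))
      atTop (nhds (c ^ n)) := by
  induction n with
  | zero => simp
  | succ n ih =>
    simp only [ascPochhammer_eval_div_succ, pow_succ]
    exact ih.mul (tendsto_linear_div_linear c n)

theorem abs_ascPochhammer_ratio_le {c t : ℝ} (hc : 1 ≤ c) (ht : 0 ≤ t) (n : ℕ) :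
    |(ascPochhammer ℝ n).eval (c * t) / (ascPochhammer ℝ n).eval (t + 1)| ≤ c ^ n := by
  induction n with
  | zero => simp
  | succ n ih =>
    rw [ascPochhammer_eval_div_succ, abs_mul, pow_succ]
    have hn : (0 : ℝ) ≤ n := n.cast_nonneg
    have h : |(c * t + n) / (t + 1 + n)| ≤ c := by
      rw [abs_of_nonneg (by positivity), div_le_iff₀ (by positivity)]
      nlinarith
    gcongr

theorem tendsto_hyp2F1_one_left {c u : ℝ} (hc : 1 ≤ c) (hu : 0 ≤ u) (hcu : c * u < 1) :
    Tendsto (fun t : ℝ => hyp2F1 1 (c * t) (t + 1) u) atTop (nhds (1 - c * u)⁻¹) := by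
  have hcu0 : 0 ≤ c * u := by positivity
  simp only [hyp2F1_one_left]
  rw [← tsum_geometric_of_lt_one hcu0 hcu]
  refine tendsto_tsum_of_dominated_convergence (bound := fun n : ℕ => (c * u) ^ n)
    (summable_geometric_of_lt_one hcu0 hcu) (fun n => ?_) ?_
  · rw [mul_pow]
    exact (tendsto_ascPochhammer_ratio c n).mul_const _
  · filter_upwards [eventually_ge_atTop 0] with t ht n
    rw [Real.norm_eq_abs, abs_mul, mul_pow, abs_of_nonneg (pow_nonneg hu n)]
    gcongr
    exact abs_ascPochhammer_ratio_le hc ht n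

theorem stmt13 (β : ℝ) (hβ0 : 0 < β) (hβ1 : β < 1) (x : ℝ)
    (hx0 : 0 ≤ x) (hx1 : x < 1) (hx : 1 < (1 + β) ^ 2 * x / (4 * β)) :
    Tendsto
      (fun t : ℝ =>
        β / ((1 + β) * Real.sqrt (1 - x)) *
          (hyp2F1 1 ((1 + β) * t) (t + 1) (1 / 2 - Real.sqrt (1 - x) / 2) -
           hyp2F1 1 ((1 + β) * t) (t + 1) (1 / 2 + Real.sqrt (1 - x) / 2)))
      atTop (nhds (-(1 / ((1 + β) ^ 2 * x / (4 * β) - 1)))) := by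
  have hs0 : 0 < Real.sqrt (1 - x) := Real.sqrt_pos.2 (by linarith)
  have hsq : Real.sqrt (1 - x) ^ 2 = 1 - x := Real.sq_sqrt (by linarith)
  have hs1 : Real.sqrt (1 - x) ≤ 1 := Real.sqrt_le_one.2 (by linarith)
  generalize Real.sqrt (1 - x) = s at *
  obtain rfl : x = 1 - s ^ 2 := by linarith
  rw [lt_div_iff₀ (by positivity)] at hx
  have hlt : (1 + β) * s < 1 - β :=
    lt_of_pow_lt_pow_left₀ 2 (by linarith) (by nlinarith)
  have hminus : (1 + β) * (1 / 2 - s / 2) < 1 := by nlinarith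
  have hplus : (1 + β) * (1 / 2 + s / 2) < 1 := by linarith
  have hlim := ((tendsto_hyp2F1_one_left (by linarith) (by linarith) hminus).sub
    (tendsto_hyp2F1_one_left (by linarith) (by linarith) hplus)).const_mul (β / ((1 + β) * s))
  convert hlim using 2
  have h1 : 1 - (1 + β) * (1 / 2 - s / 2) ≠ 0 := by linarith
  have h2 : 1 - (1 + β) * (1 / 2 + s / 2) ≠ 0 := by linarith
  have h3 : (1 + β) ^ 2 * (1 - s ^ 2) / (4 * β) - 1 =
      (1 - (1 + β) * (1 / 2 - s / 2)) * (1 - (1 + β) * (1 / 2 + s / 2)) / β := by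
    field_simp
    ring
  have h4 : (1 - (1 + β) * (1 / 2 - s / 2))⁻¹ - (1 - (1 + β) * (1 / 2 + s / 2))⁻¹ =
      -((1 + β) * s) /
        ((1 - (1 + β) * (1 / 2 - s / 2)) * (1 - (1 + β) * (1 / 2 + s / 2))) := by
    rw [inv_sub_inv h1 h2]
    ring
  rw [h3, h4]
  generalize (1 - (1 + β) * (1 / 2 - s / 2)) * (1 - (1 + β) * (1 / 2 + s / 2)) = D
  have h5 : (1 + β) * s ≠ 0 := by positivity
  rw [one_div_div, neg_div, mul_neg, div_mul_div_cancel₀ h5]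
end

section
/- Suppose r > 2, 0 < β < 1, and r² < (1+β)²/β. Then (1/r^{1+β}) · (1+β)^{1+β}/β^{β} < ( r/2 − √(r²/4 − 1) )^{1−β}. -/
open Real in
/-- Gibbs' inequality for the Bernoulli weights `β / (1 + β)` and `y / (1 + y)`. -/
theorem one_add_mul_log_sub_lt {β y : ℝ} (hβ : 0 < β) (hy : 0 < y) (hne : β ≠ y) :
    (1 + β) * log (1 + β) - β * log β < (1 + β) * log (1 + y) - β * log y := by
  have h1 : log (y * (1 + β) / (β * (1 + y))) ≤ y * (1 + β) / (β * (1 + y)) - 1 :=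
    log_le_sub_one_of_pos (by positivity)
  have h2 : log ((1 + β) / (1 + y)) < (1 + β) / (1 + y) - 1 := by
    refine log_lt_sub_one_of_pos (by positivity) fun h => hne ?_
    rw [div_eq_one_iff_eq (by positivity)] at h
    linarith
  have h3 : β * (y * (1 + β) / (β * (1 + y)) - 1) + ((1 + β) / (1 + y) - 1) = 0 := by
    field_simp
    ring
  rw [log_div (by positivity) (by positivity), log_mul (by positivity) (by positivity),
    log_mul (by positivity) (by positivity)] at h1
  rw [log_div (by positivity) (by positivity)] at h2
  nlinarith [mul_le_mul_of_nonneg_left h1 hβ.le]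

theorem stmt14 (r β : ℝ) (hr : 2 < r) (hβ0 : 0 < β) (hβ1 : β < 1)
    (h : r ^ 2 < (1 + β) ^ 2 / β) :
    (1 / r ^ (1 + β)) * ((1 + β) ^ (1 + β) / β ^ β) <
      (r / 2 - Real.sqrt (r ^ 2 / 4 - 1)) ^ (1 - β) := by
  have hs : Real.sqrt (r ^ 2 / 4 - 1) ^ 2 = r ^ 2 / 4 - 1 := Real.sq_sqrt (by nlinarith)
  have hx0 : 0 < r / 2 - Real.sqrt (r ^ 2 / 4 - 1) := by
    rw [sub_pos, Real.sqrt_lt' (by linarith)]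
    linarith
  set x := r / 2 - Real.sqrt (r ^ 2 / 4 - 1) with hx
  have hxr : r * x = 1 + x ^ 2 := by
    rw [hx]
    linear_combination -hs
  have hne : β ≠ x ^ 2 := by
    rintro rfl
    rw [← hxr, lt_div_iff₀ hβ0] at h
    exact absurd h (by rw [mul_pow]; exact lt_irrefl _)
  have hr0 : 0 < r := by linarith
  have key := one_add_mul_log_sub_lt hβ0 (pow_pos hx0 2) hne
  rw [← hxr, Real.log_mul hr0.ne' hx0.ne', Real.log_pow] at key
  push_cast at key
  rw [← Real.log_lt_log_iff (by positivity) (by positivity),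
    Real.log_mul (by positivity) (by positivity), Real.log_div (by positivity) (by positivity),
    Real.log_div (by positivity) (by positivity), Real.log_rpow hr0,
    Real.log_rpow (by positivity), Real.log_rpow hβ0, Real.log_rpow hx0, Real.log_one]
  linarith
end

section
/- For every real y with 0 ≤ y < 1 and every positive integer n, one has Σ_{k=1}^∞ k^{2n} y^k ≤ ((2n)!/2) · y(1+y)/(1−y)^{2n+1}. -/
theorem two_mul_succ_pow_le_factorial_mul_choose (m : ℕ) (hm : 2 ≤ m) (j : ℕ) :
    2 * (j + 1) ^ m ≤ m.factorial * ((j + m).choose m + (j + m - 1).choose m) := by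
  obtain ⟨M, rfl⟩ : ∃ M, m = M + 1 := ⟨m - 1, by omega⟩
  rw [mul_add, ← Nat.ascFactorial_eq_factorial_mul_choose,
    ← Nat.ascFactorial_eq_factorial_mul_choose', Nat.ascFactorial_succ]
  have h : j.ascFactorial (M + 1) = j * (j + 1).ascFactorial M := by
    rw [Nat.succ_ascFactorial, Nat.ascFactorial_succ]
  calc 2 * (j + 1) ^ (M + 1) = (2 * (j + 1)) * (j + 1) ^ M := by ring
    _ ≤ (2 * j + 1 + M) * (j + 1).ascFactorial M :=
        Nat.mul_le_mul (by omega) (Nat.pow_succ_le_ascFactorial _ _)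
    _ = (j + 1 + M) * (j + 1).ascFactorial M + j.ascFactorial (M + 1) := by rw [h]; ring

theorem hasSum_choose_add_choose_mul_geometric (m : ℕ) (hm : 0 < m) (y : ℝ) (hy : ‖y‖ < 1) :
    HasSum (fun j : ℕ ↦ (((j + m).choose m : ℝ) + ((j + m - 1).choose m : ℝ)) * y ^ (j + 1))
      (y * (1 + y) / (1 - y) ^ (m + 1)) := by
  have h := hasSum_choose_mul_geometric_of_norm_lt_one m hy
  have h₁ : HasSum (fun j : ℕ ↦ ((j + m - 1).choose m : ℝ) * y ^ j)
      (y * (1 / (1 - y) ^ (m + 1))) := by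
    have h₀ : ((0 + m - 1).choose m : ℝ) = 0 := by
      exact_mod_cast Nat.choose_eq_zero_of_lt (by omega)
    rw [← hasSum_nat_add_iff' 1, Finset.sum_range_one, h₀, zero_mul, sub_zero]
    refine Eq.mp (congrArg (HasSum · _) (funext fun j ↦ ?_)) (h.mul_left y)
    rw [show j + 1 + m - 1 = j + m by omega]
    ring
  rw [show y * (1 + y) / (1 - y) ^ (m + 1) =
    y * (1 / (1 - y) ^ (m + 1) + y * (1 / (1 - y) ^ (m + 1))) by ring]
  refine Eq.mp (congrArg (HasSum · _) (funext fun j ↦ ?_)) ((h.add h₁).mul_left y)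
  ring

theorem stmt15 (y : ℝ) (hy0 : 0 ≤ y) (hy1 : y < 1) (n : ℕ) (hn : 0 < n) :
    ∑' k : ℕ, (k : ℝ) ^ (2 * n) * y ^ k ≤
      (((2 * n).factorial : ℝ) / 2) * (y * (1 + y) / (1 - y) ^ (2 * n + 1)) := by
  have hy : ‖y‖ < 1 := by rwa [Real.norm_of_nonneg hy0]
  have hs := summable_pow_mul_geometric_of_norm_lt_one (2 * n) hy
  have hr := (hasSum_choose_add_choose_mul_geometric (2 * n) (by omega) y hy).mul_left
    (((2 * n).factorial : ℝ) / 2)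
  rw [hs.tsum_eq_zero_add, Nat.cast_zero, zero_pow (by omega), zero_mul, zero_add]
  refine hasSum_le (fun j ↦ ?_) ((summable_nat_add_iff 1).2 hs).hasSum hr
  have h : (2 * (j + 1) ^ (2 * n) : ℝ) ≤
      (2 * n).factorial * ((j + 2 * n).choose (2 * n) + (j + 2 * n - 1).choose (2 * n)) := by
    exact_mod_cast two_mul_succ_pow_le_factorial_mul_choose (2 * n) (by omega) j
  rw [← mul_assoc]
  push_cast
  exact mul_le_mul_of_nonneg_right (by linarith) (by positivity)
end

section
/- Let k₁ > k₂ > 0 be integers and set p = k₁/(k₁+k₂) (so 1 − p = k₂/(k₁+k₂)). Then lim_{t→∞} Σ_{i=0}^∞ binom(tk₁+tk₂+2i, tk₁+i) · p^{tk₁+i} · (1−p)^{tk₂+i} = (1/4)/(p − 1/2), where t ranges over the positive integers. -/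
open Filter
open MeasureTheory ProbabilityTheory Topology unitInterval

theorem integral_binomial_antidiagonal (n : ℕ) (p : I) (f : ℕ → ℝ) :
    ∫ k, f k ∂Bin(n, p) = ∑ ij ∈ Finset.HasAntidiagonal.antidiagonal n,
      (n.choose ij.1 : ℝ) * ((p : ℝ) ^ ij.1 * (1 - (p : ℝ)) ^ ij.2 * f ij.1) := by
  rw [integral_binomial, ← Nat.range_succ_eq_Iic,
    Finset.Nat.sum_antidiagonal_eq_sum_range_succ_mk]
  exact Finset.sum_congr rfl fun k _ => by simp only [smul_eq_mul]; ring

theorem integral_binomial_succ (n : ℕ) (p : I) (f : ℕ → ℝ) :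
    ∫ k, f k ∂Bin(n + 1, p) = ∫ k, ((1 - p) * f k + p * f (k + 1)) ∂Bin(n, p) := by
  simp only [integral_binomial_antidiagonal]
  rw [Finset.sum_antidiagonal_choose_succ_mul
    (fun i j => (p : ℝ) ^ i * (1 - (p : ℝ)) ^ j * f i), ← Finset.sum_add_distrib]
  refine Finset.sum_congr rfl fun ij hij => ?_
  have h : n.choose ij.2 = n.choose ij.1 :=
    Nat.choose_symm_of_eq_add (by rw [Finset.HasAntidiagonal.mem_antidiagonal] at hij; omega)
  rw [h]
  ring

theorem integral_binomial_pow (n : ℕ) (p : I) (x : ℝ) :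
    ∫ k, x ^ k ∂Bin(n, p) = (p * x + (1 - p)) ^ n := by
  rw [integral_binomial_antidiagonal, (Commute.all _ _).add_pow']
  exact Finset.sum_congr rfl fun ij _ => by rw [nsmul_eq_mul, mul_pow]; ring

theorem integral_binomial_ite_eq (a b : ℕ) (p : I) (c : ℝ) :
    ∫ k, (if k = a then c else 0) ∂Bin(a + b, p) =
      ((a + b).choose a : ℝ) * (p : ℝ) ^ a * (1 - (p : ℝ)) ^ b * c := by
  rw [integral_binomial_antidiagonal, Finset.sum_eq_single (a, b)]
  · simp; ring
  · rintro ⟨i, j⟩ hij hne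
    rw [Finset.HasAntidiagonal.mem_antidiagonal] at hij
    have : i ≠ a := by rintro rfl; exact hne (by ext <;> simp; simp at hij; omega)
    simp [this]
  · simp

theorem integral_binomial_sub_integral_binomial_diag (a b : ℕ) (p : I) (hp : 0 < (p : ℝ)) :
    (∫ k, (((1 - (p : ℝ)) / p) ^ 2) ^ (k - a) ∂Bin(a + b, p)) -
      ∫ k, (((1 - (p : ℝ)) / p) ^ 2) ^ (k - (a + 1)) ∂Bin(a + b + 2, p) =
      ((a + b).choose a : ℝ) * (p : ℝ) ^ a * (1 - (p : ℝ)) ^ b * (2 * p - 1) := by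
  rw [integral_binomial_succ, integral_binomial_succ,
    ← integral_sub (integrable_binomial _) (integrable_binomial _), ← integral_binomial_ite_eq]
  congr 1
  ext k
  rcases lt_trichotomy k a with h | rfl | h
  · rw [if_neg h.ne, show k - a = 0 by omega, show k - (a + 1) = 0 by omega,
      show k + 1 - (a + 1) = 0 by omega, show k + 1 + 1 - (a + 1) = 0 by omega]
    ring
  · rw [if_pos rfl, show k - k = 0 by omega, show k - (k + 1) = 0 by omega,
      show k + 1 - (k + 1) = 0 by omega, show k + 1 + 1 - (k + 1) = 1 by omega]
    field_simp
    ring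
  · obtain ⟨m, rfl⟩ := Nat.exists_eq_add_of_lt h
    rw [if_neg h.ne', show a + m + 1 - a = m + 1 by omega,
      show a + m + 1 - (a + 1) = m by omega, show a + m + 1 + 1 - (a + 1) = m + 1 by omega,
      show a + m + 1 + 1 + 1 - (a + 1) = m + 2 by omega]
    generalize hy : (((1 - (p : ℝ)) / p) ^ 2) ^ m = y
    rw [pow_succ, pow_add, hy]
    field_simp
    ring

theorem tendsto_integral_binomial_diag (a b : ℕ) (p : I) (hp : 1 / 2 < (p : ℝ))
    (hp1 : (p : ℝ) < 1) :
    Tendsto (fun i : ℕ =>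
      ∫ k, (((1 - (p : ℝ)) / p) ^ 2) ^ (k - (a + i)) ∂Bin(a + b + 2 * i, p)) atTop (𝓝 0) := by
  set r : ℝ := (1 - (p : ℝ)) / p with hr
  have hp0 : 0 < (p : ℝ) := by linarith
  have hr0 : 0 < r := div_pos (by linarith) hp0
  have hr1 : r ≤ 1 := by rw [hr, div_le_one hp0]; linarith
  have hpr : (p : ℝ) * r + (1 - p) = 2 * (1 - p) := by rw [hr]; field_simp; ring
  have hlim : Tendsto (fun i : ℕ => (2 * (1 - (p : ℝ))) ^ (a + b) * (r ^ a)⁻¹ *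
      (4 * (1 - p) * p) ^ i) atTop (𝓝 0) := by
    rw [← mul_zero ((2 * (1 - (p : ℝ))) ^ (a + b) * (r ^ a)⁻¹)]
    exact (tendsto_pow_atTop_nhds_zero_of_lt_one (by nlinarith) (by nlinarith)).const_mul _
  refine squeeze_zero (fun i => integral_nonneg fun k => by positivity) (fun i => ?_) hlim
  calc ∫ k, (r ^ 2) ^ (k - (a + i)) ∂Bin(a + b + 2 * i, p)
      ≤ ∫ k, r ^ k * (r ^ (a + i))⁻¹ ∂Bin(a + b + 2 * i, p) := by
        refine integral_mono (integrable_binomial _) (integrable_binomial _) fun k => ?_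
        rw [← div_eq_mul_inv, le_div_iff₀ (by positivity), ← pow_mul, ← pow_add]
        exact pow_le_pow_of_le_one hr0.le hr1 (by omega)
    _ = _ := by
        rw [integral_mul_const, integral_binomial_pow, hpr, pow_add, pow_mul, pow_add r, mul_inv]
        have : (2 * (1 - (p : ℝ))) ^ 2 = 4 * (1 - p) * p * r := by rw [hr]; field_simp; ring
        rw [this, mul_pow _ r]
        field_simp

theorem hasSum_binomial_diag (a b : ℕ) (p : I) (hp : 1 / 2 < (p : ℝ)) (hp1 : (p : ℝ) < 1) :
    HasSum (fun i : ℕ => ((a + b + 2 * i).choose (a + i) : ℝ) * (p : ℝ) ^ (a + i) *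
        (1 - (p : ℝ)) ^ (b + i))
      ((∫ k, (((1 - (p : ℝ)) / p) ^ 2) ^ (k - a) ∂Bin(a + b, p)) / (2 * p - 1)) := by
  have hp0 : 0 < (p : ℝ) := by linarith
  have hq0 : 0 < 1 - (p : ℝ) := by linarith
  have hpq : 0 < 2 * (p : ℝ) - 1 := by linarith
  rw [hasSum_iff_tendsto_nat_of_nonneg fun i => by positivity]
  set T : ℕ → ℝ := fun i =>
    ∫ k, (((1 - (p : ℝ)) / p) ^ 2) ^ (k - (a + i)) ∂Bin(a + b + 2 * i, p) with hT
  have hsum (n : ℕ) : ∑ i ∈ Finset.range n, ((a + b + 2 * i).choose (a + i) : ℝ) *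
      (p : ℝ) ^ (a + i) * (1 - (p : ℝ)) ^ (b + i) = (T 0 - T n) / (2 * p - 1) := by
    rw [← Finset.sum_range_sub' T n, Finset.sum_div]
    refine Finset.sum_congr rfl fun i _ => ?_
    rw [eq_div_iff hpq.ne', hT]
    have h := integral_binomial_sub_integral_binomial_diag (a + i) (b + i) p hp0
    rw [show a + i + (b + i) = a + b + 2 * i by ring] at h
    exact h.symm
  simp_rw [hsum]
  have :=
    ((tendsto_integral_binomial_diag a b p hp hp1).const_sub (T 0)).div_const (2 * (p : ℝ) - 1)
  simpa [hT] using this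

theorem charFun_map_binomial (n : ℕ) (p : I) (c t : ℝ) :
    charFun (Bin(n, p).map fun k : ℕ => c * (k - n * p)) t =
      charFun (Bin(1, p).map fun k : ℕ => (k - p : ℝ)) (c * t) ^ n := by
  rw [charFun_apply_real, charFun_apply_real,
    integral_map (by fun_prop) (by fun_prop), integral_map (by fun_prop) (by fun_prop),
    integral_binomial, integral_binomial, ← Nat.range_succ_eq_Iic, ← Nat.range_succ_eq_Iic,
    Finset.sum_range_succ (n := 1), Finset.sum_range_one]
  conv_rhs => rw [add_comm, add_pow]
  refine Finset.sum_congr rfl fun k hk => ?_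
  obtain ⟨m, rfl⟩ := Nat.exists_eq_add_of_le (Finset.mem_range_succ_iff.1 hk)
  simp only [Complex.real_smul, Nat.add_sub_cancel_left, mul_pow, ← Complex.exp_nat_mul]
  have : Complex.exp (t * (c * (k - (k + m : ℕ) * (p : ℝ)) : ℝ) * Complex.I) =
      Complex.exp (k * ((c * t : ℝ) * ((1 : ℕ) - (p : ℝ) : ℝ) * Complex.I)) *
      Complex.exp (m * ((c * t : ℝ) * ((0 : ℕ) - (p : ℝ) : ℝ) * Complex.I)) := by
    rw [← Complex.exp_add]
    congr 1
    push_cast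
    ring
  rw [this]
  simp
  ring

theorem tendsto_binomial_standardized (p : I) (hp0 : 0 < (p : ℝ)) (hp1 : (p : ℝ) < 1) (x : ℝ) :
    Tendsto (fun n : ℕ => Bin(n, p).real
      {k : ℕ | (k : ℝ) - n * p ≤ x * (√n * √(p * (1 - p)))}) atTop
      (𝓝 (cdf (gaussianReal 0 1) x)) := by
  set d : ℝ := √(p * (1 - p)) with hd
  have hpq : 0 < (p : ℝ) * (1 - p) := mul_pos hp0 (by linarith)
  have hd0 : 0 < d := Real.sqrt_pos.2 hpq
  have hd2 : d ^ 2 = p * (1 - p) := Real.sq_sqrt hpq.le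
  let Z (n : ℕ) : ProbabilityMeasure ℝ :=
    ⟨Bin(n, p).map fun k : ℕ => (√n)⁻¹ * d⁻¹ * (k - n * p : ℝ),
      Measure.isProbabilityMeasure_map (by fun_prop)⟩
  let G : ProbabilityMeasure ℝ := ⟨gaussianReal 0 1, inferInstance⟩
  have hZ : Tendsto Z atTop (𝓝 G) := by
    refine ProbabilityMeasure.tendsto_iff_tendsto_charFun.2 fun t => ?_
    have hint (f : ℕ → ℝ) : ∫ k, f k ∂Bin(1, p) = (1 - p) * f 0 + p * f 1 := by
      rw [integral_binomial, ← Nat.range_succ_eq_Iic, Finset.sum_range_succ, Finset.sum_range_one]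
      simp
    have h := tendsto_charFun_inv_sqrt_mul_pow (P := Bin(1, p))
      (X := fun k : ℕ => d⁻¹ * (k - p : ℝ)) (by fun_prop)
      (by rw [hint]; push_cast; ring)
      (by
        simp only [Pi.pow_apply]
        rw [hint]
        push_cast
        field_simp
        rw [hd2]
        ring) t
    simp only [Z, G, ProbabilityMeasure.coe_mk, charFun_map_binomial, charFun_gaussianReal]
    convert! h using 1
    · ext n
      rw [charFun_map_mul_comp (by fun_prop)]
      congr 2
      ring
    · simp [neg_div]
  have hfr : (G : Measure ℝ) (frontier (Set.Iic x)) = 0 := by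
    have : NullSingletonClass (gaussianReal 0 1) := nullSingletonClass_gaussianReal one_ne_zero
    simp [G]
  have h := (ENNReal.tendsto_toReal (measure_ne_top _ _)).comp
    (ProbabilityMeasure.tendsto_measure_of_null_frontier_of_tendsto' hZ hfr)
  rw [ProbabilityTheory.cdf_eq_real]
  refine h.congr' ?_
  filter_upwards [eventually_gt_atTop 0] with n hn
  have hn' : 0 < √(n : ℝ) := Real.sqrt_pos.2 (by exact_mod_cast hn)
  simp only [Function.comp_apply, Z, ProbabilityMeasure.coe_mk]
  rw [Measure.map_apply (by fun_prop) measurableSet_Iic, measureReal_def]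
  congr 2
  ext k
  simp only [Set.mem_preimage, Set.mem_Iic, Set.mem_ofPred_eq]
  rw [← mul_inv, inv_mul_le_iff₀ (by positivity), mul_comm x]

theorem cdf_gaussianReal_zero : cdf (gaussianReal 0 1) 0 = 1 / 2 := by
  have : NullSingletonClass (gaussianReal 0 1) := nullSingletonClass_gaussianReal one_ne_zero
  have hneg : (gaussianReal 0 1).real (Set.Ioi 0) = (gaussianReal 0 1).real (Set.Iic 0) := by
    have h := gaussianReal_map_neg (μ := 0) (v := 1)
    rw [neg_zero] at h
    rw [measureReal_congr (Iio_ae_eq_Iic (a := (0 : ℝ))).symm]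
    conv_lhs => rw [← h]
    rw [map_measureReal_apply (by fun_prop) measurableSet_Ioi]
    congr 1
    ext x
    simp
  have h := probReal_compl_eq_one_sub (μ := gaussianReal 0 1) (measurableSet_Iic (a := (0 : ℝ)))
  rw [Set.compl_Iic, hneg] at h
  rw [ProbabilityTheory.cdf_eq_real]
  linarith

theorem tendsto_integral_binomial_excess (p : I) (hp0 : 0 < (p : ℝ)) (hp1 : (p : ℝ) < 1)
    {s : ℝ} (hs0 : 0 ≤ s) (hs1 : s < 1) {N a : ℕ → ℕ} (hN : Tendsto N atTop atTop)
    (ha : ∀ t, (a t : ℝ) = N t * p) :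
    Tendsto (fun t => ∫ k, s ^ (k - a t) ∂Bin(N t, p)) atTop (𝓝 (1 / 2)) := by
  set F : ℝ → ℕ → Set ℕ :=
    fun x n => {k : ℕ | (k : ℝ) - n * p ≤ x * (√n * √(p * (1 - p)))} with hF
  have hF_lim (x : ℝ) : Tendsto (fun t => Bin(N t, p).real (F x (N t))) atTop
      (𝓝 (cdf (gaussianReal 0 1) x)) := (tendsto_binomial_standardized p hp0 hp1 x).comp hN
  have hint (x : ℝ) (n : ℕ) : ∫ k, (F x n).indicator 1 k ∂Bin(n, p) = Bin(n, p).real (F x n) :=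
    integral_indicator_one .of_discrete
  rw [← cdf_gaussianReal_zero]
  refine tendsto_order.2 ⟨fun l hl => ?_, fun u hu => ?_⟩
  · filter_upwards [(tendsto_order.1 (hF_lim 0)).1 l hl] with t ht
    refine ht.trans_le ?_
    rw [← hint]
    refine integral_mono (integrable_binomial _) (integrable_binomial _) fun k => ?_
    by_cases hk : k ∈ F 0 (N t)
    · have : k ≤ a t := by
        simp only [hF, Set.mem_ofPred_eq, zero_mul, ← ha, sub_nonpos, Nat.cast_le] at hk
        exact hk
      simp [hk, Nat.sub_eq_zero_of_le this]
    · simp only [Set.indicator_of_notMem hk]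
      positivity
  · obtain ⟨v, hv, hvu⟩ := exists_between hu
    have hright : Tendsto (cdf (gaussianReal 0 1)) (𝓝[>] 0) (𝓝 (cdf (gaussianReal 0 1) 0)) :=
      ((cdf (gaussianReal 0 1)).right_continuous 0).mono_left
        (nhdsWithin_mono _ Set.Ioi_subset_Ici_self)
    obtain ⟨x, hx, hx0⟩ := (((tendsto_order.1 hright).2 v hv).and self_mem_nhdsWithin).exists
    obtain ⟨M, hM⟩ := exists_pow_lt_of_lt_one (sub_pos.2 hvu) hs1
    have hlarge : Tendsto (fun t => x * (√(N t : ℝ) * √(p * (1 - p)))) atTop atTop := by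
      refine Tendsto.const_mul_atTop hx0 (Tendsto.atTop_mul_const ?_ ?_)
      · exact Real.sqrt_pos.2 (mul_pos hp0 (by linarith))
      · exact Real.tendsto_sqrt_atTop.comp (tendsto_natCast_atTop_atTop.comp hN)
    filter_upwards [(tendsto_order.1 (hF_lim x)).2 v hx, hlarge.eventually_ge_atTop (M : ℝ)]
      with t ht hMt
    calc ∫ k, s ^ (k - a t) ∂Bin(N t, p)
        ≤ ∫ k, ((F x (N t)).indicator 1 k + s ^ M) ∂Bin(N t, p) := by
          refine integral_mono (integrable_binomial _) (integrable_binomial _) fun k => ?_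
          by_cases hk : k ∈ F x (N t)
          · simp only [Set.indicator_of_mem hk, Pi.one_apply]
            have := pow_le_one₀ (n := k - a t) hs0 hs1.le
            have := pow_nonneg hs0 M
            linarith
          · simp only [Set.indicator_of_notMem hk, zero_add]
            refine pow_le_pow_of_le_one hs0 hs1.le ?_
            simp only [hF, Set.mem_ofPred_eq, not_le, ← ha] at hk
            have : (a t + M : ℝ) < k := by linarith
            have : a t + M < k := by exact_mod_cast this
            omega
      _ = Bin(N t, p).real (F x (N t)) + s ^ M := by
          rw [integral_add (integrable_binomial _) (integrable_binomial _), hint]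
          simp
      _ < u := by linarith

theorem stmt16 (k1 k2 : ℕ) (hk2 : 0 < k2) (hk12 : k2 < k1) :
    Tendsto
      (fun t : ℕ =>
        ∑' i : ℕ,
          ((t * k1 + t * k2 + 2 * i).choose (t * k1 + i) : ℝ) *
            ((k1 : ℝ) / ((k1 : ℝ) + (k2 : ℝ))) ^ (t * k1 + i) *
            (1 - (k1 : ℝ) / ((k1 : ℝ) + (k2 : ℝ))) ^ (t * k2 + i))
      atTop
      (nhds ((1 / 4) / ((k1 : ℝ) / ((k1 : ℝ) + (k2 : ℝ)) - 1 / 2))) := by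
  have hk2' : (0 : ℝ) < k2 := by exact_mod_cast hk2
  have hk12' : (k2 : ℝ) < k1 := by exact_mod_cast hk12
  have hk : (0 : ℝ) < k1 + k2 := by linarith
  have hhalf : 1 / 2 < (k1 : ℝ) / (k1 + k2) := by rw [lt_div_iff₀ hk]; linarith
  have hone : (k1 : ℝ) / (k1 + k2) < 1 := by rw [div_lt_one hk]; linarith
  obtain ⟨p, hp⟩ : ∃ p : I, (p : ℝ) = (k1 : ℝ) / (k1 + k2) :=
    ⟨⟨(k1 : ℝ) / (k1 + k2), by linarith, hone.le⟩, rfl⟩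
  have hmean (t : ℕ) : ((t * k1 : ℕ) : ℝ) = (t * k1 + t * k2 : ℕ) * (p : ℝ) := by
    rw [hp]
    push_cast
    field_simp
  rw [← hp] at hhalf hone ⊢
  simp_rw [fun t => (hasSum_binomial_diag (t * k1) (t * k2) p hhalf hone).tsum_eq]
  have hN : Tendsto (fun t => t * k1 + t * k2) atTop atTop :=
    tendsto_atTop_mono (fun t => (Nat.le_mul_of_pos_right t (hk2.trans hk12)).trans le_self_add)
      tendsto_id
  have hratio : (1 - (p : ℝ)) / p < 1 := by rw [div_lt_one (by linarith)]; linarith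
  have hratio0 : 0 ≤ (1 - (p : ℝ)) / p := div_nonneg (by linarith) (by linarith)
  have h := (tendsto_integral_binomial_excess p (by linarith) hone (sq_nonneg ((1 - (p : ℝ)) / p))
    (pow_lt_one₀ hratio0 hratio two_ne_zero) hN hmean).div_const (2 * (p : ℝ) - 1)
  convert h using 2
  have : 2 * (p : ℝ) - 1 ≠ 0 := by linarith
  have : (p : ℝ) - 1 / 2 ≠ 0 := by linarith
  field_simp
  ring
end
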